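/- arXiv:2601.02257 — 10 statements merged into one kernel-verified Lean document; each statement's English description precedes it below -/
import Mathlib

section
/- Let T ≥ k ≥ 1 and D ≥ 1 be integers, with S_{D,k} ⊆ ℤ^T. Then for every Δ ∈ S_{D,k} there exist non-negative integers k_1, …, k_D with k_1 + … + k_D = k and vectors Δ^(1), …, Δ^(D) ∈ ℤ^T such that Δ = Σ_{d=1}^{D} Δ^(d) and Δ^(d) ∈ S_{1,k_d} for every d ∈ {1,…,D}. -/
/-- `Δ ∈ S_D`: every interval sum of `Δ` is bounded by `D` in absolute value. -/
def memS (T D : ℕ) (Δ : Fin T → ℤ) : Prop :=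
  ∀ i j : Fin T, i ≤ j → |∑ t ∈ Finset.Icc i j, Δ t| ≤ (D : ℤ)

/-- The sensitivity vector set `S_{D,k}`. -/
def SDk (T D k : ℕ) : Set (Fin T → ℤ) :=
  {Δ | memS T D Δ ∧ (∑ t, |Δ t|) ≤ (k : ℤ)}

theorem aux_tele (T : ℕ) (g : Fin T → ℤ) (G : ℕ → ℤ)
    (h : ∀ t : Fin T, g t = G (t + 1) - G t) (i j : Fin T) (hij : i ≤ j) :
    ∑ t ∈ Finset.Icc i j, g t = G (j + 1) - G i := by
  have h1 : ∑ t ∈ Finset.Icc i j, g t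
      = ∑ n ∈ (Finset.Icc i j).map Fin.valEmbedding, (G (n + 1) - G n) := by
    rw [Finset.sum_map]
    exact Finset.sum_congr rfl fun t _ => h t
  rw [h1, Fin.map_valEmbedding_Icc]
  have h2 : Finset.Icc (i : ℕ) j = Finset.Ico (i : ℕ) (j + 1) := by
    ext x; simp only [Finset.mem_Icc, Finset.mem_Ico]; omega
  have h3 : (i : ℕ) ≤ j := hij
  rw [h2, Finset.sum_Ico_eq_sub _ (by omega), Finset.sum_range_sub, Finset.sum_range_sub]
  ring

theorem aux_count (D : ℕ) (a : ℤ) (h0 : 0 ≤ a) :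
    ∑ d ∈ Finset.range D, (if (d : ℤ) + 1 ≤ a then (1 : ℤ) else 0) = min a D := by
  induction D with
  | zero => simp [h0]
  | succ n ih =>
    rw [Finset.sum_range_succ, ih]
    push_cast
    split_ifs <;> omega

theorem aux_count' (D : ℕ) (a : ℤ) (h0 : 0 ≤ a) (h1 : a ≤ D) :
    ∑ d : Fin D, (if ((d : ℕ) : ℤ) + 1 ≤ a then (1 : ℤ) else 0) = a := by
  rw [Fin.sum_univ_eq_sum_range (fun d : ℕ => if (d : ℤ) + 1 ≤ a then (1 : ℤ) else 0) D,
    aux_count D a h0]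
  omega

theorem aux_abs (D : ℕ) (a b : ℤ) (h0 : 0 ≤ a) (h1 : a ≤ D) (h2 : 0 ≤ b) (h3 : b ≤ D) :
    ∑ d : Fin D, |(if ((d : ℕ) : ℤ) + 1 ≤ a then (1 : ℤ) else 0) -
      (if ((d : ℕ) : ℤ) + 1 ≤ b then (1 : ℤ) else 0)| = |a - b| := by
  rcases le_total b a with h | h
  · rw [abs_of_nonneg (sub_nonneg.2 h)]
    conv_rhs => rw [← aux_count' D a h0 h1, ← aux_count' D b h2 h3, ← Finset.sum_sub_distrib]
    refine Finset.sum_congr rfl fun d _ => abs_of_nonneg ?_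
    split_ifs <;> omega
  · rw [abs_of_nonpos (sub_nonpos.2 h), neg_sub]
    conv_rhs => rw [← aux_count' D a h0 h1, ← aux_count' D b h2 h3, ← Finset.sum_sub_distrib]
    refine Finset.sum_congr rfl fun d _ => ?_
    rw [abs_of_nonpos, neg_sub]
    split_ifs <;> omega

theorem stmt4 (T k D : ℕ) (hk1 : 1 ≤ k) (hkT : k ≤ T) (hD : 1 ≤ D)
    (Δ : Fin T → ℤ) (hΔ : Δ ∈ SDk T D k) :
    ∃ (ks : Fin D → ℕ) (Δs : Fin D → (Fin T → ℤ)),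
      (∑ d, ks d = k) ∧ (Δ = ∑ d, Δs d) ∧ ∀ d, Δs d ∈ SDk T 1 (ks d) := by
  obtain ⟨hS, hN⟩ := hΔ
  obtain ⟨P, hP⟩ : ∃ P : ℕ → ℤ, ∀ t : Fin T, Δ t = P (t + 1) - P t := by
    refine ⟨fun n => ∑ i ∈ Finset.range n, if h : i < T then Δ ⟨i, h⟩ else 0, fun t => ?_⟩
    simp [Finset.sum_range_succ]
  obtain ⟨n0, hn0, hmin⟩ := Finset.exists_min_image (Finset.range (T + 1)) P ⟨0, by simp⟩
  have hdiff : ∀ a b : ℕ, a < b → b ≤ T → |P b - P a| ≤ D := by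
    intro a b hab hb
    have h := hS ⟨a, by omega⟩ ⟨b - 1, by omega⟩ (by simp [Fin.le_def]; omega)
    rw [aux_tele T Δ P hP _ _ (by simp [Fin.le_def]; omega)] at h
    have e : b - 1 + 1 = b := by omega
    simpa [e] using h
  obtain ⟨Q, hQ⟩ : ∃ Q : ℕ → ℤ, ∀ n, Q n = P n - P n0 := ⟨_, fun _ => rfl⟩
  have hQ0 : ∀ n, n ≤ T → 0 ≤ Q n := by
    intro n hn
    have := hmin n (by simp; omega)
    rw [hQ]; omega
  have hQD : ∀ n, n ≤ T → Q n ≤ D := by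
    intro n hn
    simp at hn0
    rw [hQ]
    rcases lt_trichotomy n n0 with h | h | h
    · have := abs_le.1 (hdiff n n0 h (by omega)); omega
    · subst h; simp
    · have := abs_le.1 (hdiff n0 n h hn); omega
  have hΔQ : ∀ t : Fin T, Δ t = Q (t + 1) - Q t := by
    intro t; rw [hP, hQ, hQ]; ring
  let F : Fin D → ℕ → ℤ := fun d n => if ((d : ℕ) : ℤ) + 1 ≤ Q n then 1 else 0
  let G : Fin D → Fin T → ℤ := fun d t => F d (t + 1) - F d t
  have hsum : ∑ d, ∑ t, |G d t| = ∑ t, |Δ t| := by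
    rw [Finset.sum_comm]
    refine Finset.sum_congr rfl fun t _ => ?_
    rw [hΔQ]
    have := t.2
    exact aux_abs D _ _ (hQ0 _ (by omega)) (hQD _ (by omega)) (hQ0 _ (by omega)) (hQD _ (by omega))
  let L : Fin D → ℕ := fun d => ∑ t, (G d t).natAbs
  have hL : ∀ d, (L d : ℤ) = ∑ t, |G d t| := by
    intro d; simp [L]
  have hLk : ∑ d, L d ≤ k := by
    have : ((∑ d, L d : ℕ) : ℤ) ≤ k := by
      push_cast
      rw [Finset.sum_congr rfl fun d _ => hL d, hsum]
      exact hN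
    exact_mod_cast this
  let d0 : Fin D := ⟨0, hD⟩
  refine ⟨fun d => L d + if d = d0 then k - ∑ d, L d else 0, G, ?_, ?_, ?_⟩
  · rw [Finset.sum_add_distrib]
    simp only [Finset.sum_ite_eq', Finset.mem_univ, if_true]
    omega
  · funext t
    have := t.2
    rw [Finset.sum_apply, hΔQ]
    simp only [G, F]
    rw [Finset.sum_sub_distrib, aux_count' D _ (hQ0 _ (by omega)) (hQD _ (by omega)),
      aux_count' D _ (hQ0 _ (by omega)) (hQD _ (by omega))]
  · intro d
    refine ⟨fun i j hij => ?_, ?_⟩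
    · rw [aux_tele T (G d) (F d) (fun t => rfl) i j hij]
      simp only [F]
      split_ifs <;> simp
    · rw [← hL]
      push_cast
      omega
end

section
/- Let R ∈ ℝ^{T×T} be a lower-triangular Toeplitz matrix with non-negative, non-increasing diagonal values, and let c(i,j) = (Rᵀ R)[i,j] for i,j ∈ {0,…,T−1}. Then: (1) c(i,j) = c(j,i) for all i,j; (2) for all 0 ≤ i ≤ j ≤ T−1 and all 0 ≤ m ≤ T−1−j, c(i,j) ≥ c(i, j+m); and (3) for all 0 ≤ i,j ≤ T−1 and all 0 ≤ m ≤ T−1−max(i,j), c(i,j) ≥ c(i+m, j+m). -/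
open Matrix

theorem shift_sum_le (T m : ℕ) (hm : m ≤ T) (F G : ℕ → ℝ) (h0 : ∀ k < m, F k = 0)
    (hG : ∀ k < T, 0 ≤ G k) (hFG : ∀ k, m + k < T → F (m + k) ≤ G k) :
    ∑ k ∈ Finset.range T, F k ≤ ∑ k ∈ Finset.range T, G k := by
  obtain ⟨n, rfl⟩ := Nat.exists_eq_add_of_le hm
  rw [Finset.sum_range_add, Finset.sum_eq_zero (fun k hk => h0 k (Finset.mem_range.1 hk)), zero_add]
  refine (Finset.sum_le_sum (fun k hk => hFG k ?_)).trans
    (Finset.sum_le_sum_of_subset_of_nonneg ?_ ?_)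
  · have := Finset.mem_range.1 hk
    omega
  · intro k hk
    simp only [Finset.mem_range] at *
    omega
  · intro k hk _
    exact hG k (Finset.mem_range.1 hk)

theorem stmt6 (T : ℕ) (hT : 1 ≤ T) (r : ℕ → ℝ)
    (hnn : ∀ t < T, 0 ≤ r t)
    (hmono : ∀ s t : ℕ, s ≤ t → t < T → r t ≤ r s)
    (R : Matrix (Fin T) (Fin T) ℝ)
    (hR : ∀ i j : Fin T, R i j = if (j : ℕ) ≤ (i : ℕ) then r ((i : ℕ) - (j : ℕ)) else 0)
    (c : Fin T → Fin T → ℝ) (hc : ∀ i j, c i j = (Rᵀ * R) i j) :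
    (∀ i j, c i j = c j i) ∧
      (∀ i j : Fin T, i ≤ j → ∀ (m : ℕ) (hm : (j : ℕ) + m < T),
        c i ⟨(j : ℕ) + m, hm⟩ ≤ c i j) ∧
      (∀ i j : Fin T, ∀ (m : ℕ) (hi : (i : ℕ) + m < T) (hj : (j : ℕ) + m < T),
        c ⟨(i : ℕ) + m, hi⟩ ⟨(j : ℕ) + m, hj⟩ ≤ c i j) := by
  have hc' : ∀ i j : Fin T, c i j = ∑ k ∈ Finset.range T,
      (if (i : ℕ) ≤ k then r (k - i) else 0) * (if (j : ℕ) ≤ k then r (k - j) else 0) := by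
    intro i j
    rw [hc, Matrix.mul_apply, Finset.sum_range]
    simp only [Matrix.transpose_apply, hR]
  have hpos : ∀ a k : ℕ, k < T → 0 ≤ (if a ≤ k then r (k - a) else 0) := by
    intro a k hk
    split_ifs
    · exact hnn _ (by omega)
    · exact le_rfl
  have hG : ∀ a b k : ℕ, k < T →
      0 ≤ (if a ≤ k then r (k - a) else 0) * (if b ≤ k then r (k - b) else 0) :=
    fun a b k hk => mul_nonneg (hpos a k hk) (hpos b k hk)
  have hshift : ∀ a m k : ℕ, (if a + m ≤ m + k then r (m + k - (a + m)) else 0)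
      = (if a ≤ k then r (k - a) else 0) := by
    intro a m k
    have h1 : m + k - (a + m) = k - a := by omega
    have h2 : a + m ≤ m + k ↔ a ≤ k := by omega
    simp only [h1, h2]
  refine ⟨?_, ?_, ?_⟩
  · intro i j
    rw [hc', hc']
    exact Finset.sum_congr rfl (fun k _ => mul_comm _ _)
  · intro i j hij m hm
    have hij' : (i : ℕ) ≤ j := hij
    rw [hc', hc']
    refine shift_sum_le T m (by omega) _ _ ?_ (hG _ _) ?_
    · intro k hk
      have : ¬ ((j : ℕ) + m ≤ k) := by omega
      simp [this]
    · intro k hk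
      simp only [hshift]
      by_cases hjk : (j : ℕ) ≤ k
      · refine mul_le_mul_of_nonneg_right ?_ (hpos _ _ (by omega))
        rw [if_pos (by omega), if_pos (by omega)]
        exact hmono _ _ (by omega) (by omega)
      · simp [hjk]
  · intro i j m hi hj
    rw [hc', hc']
    refine shift_sum_le T m (by omega) _ _ ?_ (hG _ _) ?_
    · intro k hk
      have : ¬ ((j : ℕ) + m ≤ k) := by omega
      simp [this]
    · intro k hk
      simp only [hshift]
      exact le_rfl
end

section
/- Let T, k, D ≥ 1 be integers, and let R ∈ ℝ^{T×T} be a lower-triangular Toeplitz matrix with non-negative, non-increasing diagonal values. Then for every Δ ∈ S_{D,k}, ‖RΔ‖₂ ≤ √(kD) · ‖R‖_{1→2}; equivalently, sens_2(R, S_{D,k}) ≤ √(kD) · ‖R‖_{1→2}. -/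
/-- The ℓp norm of a finite real vector. -/
noncomputable def pnorm (p : ℝ) {ι : Type} [Fintype ι] (x : ι → ℝ) : ℝ :=
  (∑ i, |x i| ^ p) ^ (1 / p)

/-- `sens_p(R, S)`: the maximum of `‖RΔ‖_p` over `Δ ∈ S`. -/
noncomputable def sens (p : ℝ) {ι : Type} [Fintype ι] {T : ℕ}
    (R : Matrix ι (Fin T) ℝ) (S : Set (Fin T → ℤ)) : ℝ :=
  sSup ((fun Δ => pnorm p (R.mulVec fun t => (Δ t : ℝ))) '' S)

/-- `‖R‖_{1→2}`: the maximum ℓ₂ norm of a column of `R`. -/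
noncomputable def colNorm2 {ι : Type} [Fintype ι] {T : ℕ} (R : Matrix ι (Fin T) ℝ) : ℝ :=
  sSup (Set.range fun j : Fin T => pnorm 2 fun i => R i j)

lemma unimodal_bound (f P : ℕ → ℝ) (T j : ℕ) (hj : j ≤ T) (m M : ℝ)
    (hm : ∀ n ≤ T, m ≤ P n) (hM : ∀ n ≤ T, P n ≤ M)
    (hf : ∀ n, 0 ≤ f n) (hup : ∀ n < j, f n ≤ f (n+1))
    (hdn : ∀ n, j ≤ n → f (n+1) ≤ f n) :
    ∑ l ∈ Finset.range T, f l * (P (l+1) - P l) ≤ f j * (M - m) := by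
  have h1 : ∀ n, n ≤ j → ∑ l ∈ Finset.range n, f l * (P (l+1) - P l) ≤ f n * (P n - m) := by
    intro n
    induction n with
    | zero =>
      intro _
      simpa using mul_nonneg (hf 0) (sub_nonneg.2 (hm 0 (by omega)))
    | succ n ih =>
      intro hn
      rw [Finset.sum_range_succ]
      have := ih (by omega)
      have h2 := mul_le_mul_of_nonneg_right (hup n (by omega))
        (sub_nonneg.2 (hm (n+1) (by omega)))
      linarith
  have h2 : ∀ n, j ≤ n → n ≤ T → ∑ l ∈ Finset.range n, f l * (P (l+1) - P l)
      ≤ f j * (M - m) - f n * (M - P n) := by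
    intro n hn
    induction n, hn using Nat.le_induction with
    | base =>
      intro _
      have := h1 j le_rfl
      linarith
    | succ n hn ih =>
      intro hT
      rw [Finset.sum_range_succ]
      have := ih (by omega)
      have h2 := mul_le_mul_of_nonneg_right (hdn n hn)
        (sub_nonneg.2 (hM (n+1) (by omega)))
      linarith
  have := h2 T hj le_rfl
  have h3 := mul_nonneg (hf T) (sub_nonneg.2 (hM T le_rfl))
  linarith

lemma unimodal_abs (f P : ℕ → ℝ) (T j : ℕ) (hj : j ≤ T) (D : ℝ)
    (hP : ∀ a ≤ T, ∀ b ≤ T, P a - P b ≤ D)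
    (hf : ∀ n, 0 ≤ f n) (hup : ∀ n < j, f n ≤ f (n+1))
    (hdn : ∀ n, j ≤ n → f (n+1) ≤ f n) :
    |∑ l ∈ Finset.range T, f l * (P (l+1) - P l)| ≤ f j * D := by
  obtain ⟨a, ha, haM⟩ := Finset.exists_max_image (Finset.range (T+1)) P ⟨0, by simp⟩
  obtain ⟨b, hb, hbm⟩ := Finset.exists_min_image (Finset.range (T+1)) P ⟨0, by simp⟩
  simp only [Finset.mem_range, Nat.lt_succ_iff] at ha hb haM hbm
  have hD := mul_le_mul_of_nonneg_left (hP a ha b hb) (hf j)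
  have h1 := unimodal_bound f P T j hj (P b) (P a) hbm haM hf hup hdn
  have h2 := unimodal_bound f (fun n => - P n) T j hj (-P a) (-P b)
    (fun n hn => neg_le_neg (haM n hn)) (fun n hn => neg_le_neg (hbm n hn)) hf hup hdn
  have h3 : ∑ l ∈ Finset.range T, f l * ((fun n => - P n) (l+1) - (fun n => - P n) l)
      = - ∑ l ∈ Finset.range T, f l * (P (l+1) - P l) := by
    rw [← Finset.sum_neg_distrib]
    exact Finset.sum_congr rfl fun l _ => by ring
  rw [h3] at h2
  rw [abs_le]
  constructor <;> linarith

lemma prefix_diff (T D : ℕ) (Δ : Fin T → ℤ) (h : memS T D Δ) (x : ℕ → ℝ)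
    (hx : ∀ t : Fin T, x t = Δ t) (a b : ℕ) (hab : a ≤ b) (hb : b ≤ T) :
    |∑ t ∈ Finset.range b, x t - ∑ t ∈ Finset.range a, x t| ≤ (D : ℝ) := by
  rw [← Finset.sum_Ico_eq_sub _ hab]
  rcases hab.eq_or_lt with rfl | hlt
  · simp
  have h1 := h ⟨a, by omega⟩ ⟨b-1, by omega⟩ (by simp [Fin.le_def]; omega)
  have h2 : ∑ t ∈ Finset.Ico a b, x t
      = ((∑ t ∈ Finset.Icc (⟨a, by omega⟩ : Fin T) ⟨b-1, by omega⟩, Δ t : ℤ) : ℝ) := by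
    push_cast
    symm
    apply Finset.sum_bij (fun (t : Fin T) _ => (t : ℕ))
    · intro t ht
      simp [Fin.le_def] at ht ⊢
      omega
    · intro s _ t _ hst
      exact Fin.ext hst
    · intro t ht
      simp only [Finset.mem_Ico] at ht
      exact ⟨⟨t, by omega⟩, by simp [Fin.le_def]; omega, rfl⟩
    · intro t _
      exact (hx t).symm
  rw [h2]
  exact_mod_cast h1

lemma pnorm_two {ι : Type} [Fintype ι] (x : ι → ℝ) : pnorm 2 x = Real.sqrt (∑ i, x i ^ 2) := by
  unfold pnorm
  rw [Real.sqrt_eq_rpow]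
  congr 1
  refine Finset.sum_congr rfl fun i _ => ?_
  rw [Real.rpow_two, sq_abs]

lemma gram_bound (T D : ℕ) (Δ : Fin T → ℤ) (h : memS T D Δ)
    (r : ℕ → ℝ) (hnn : ∀ t < T, 0 ≤ r t)
    (hmono : ∀ s t : ℕ, s ≤ t → t < T → r t ≤ r s)
    (R : Matrix (Fin T) (Fin T) ℝ)
    (hR : ∀ i j : Fin T, R i j = if (j : ℕ) ≤ (i : ℕ) then r ((i : ℕ) - (j : ℕ)) else 0)
    (j : Fin T) :
    |∑ l, (∑ i, R i j * R i l) * (Δ l : ℝ)| ≤ (∑ i, R i j ^ 2) * D := by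
  set ρ : ℕ → ℕ → ℝ := fun i j => if j ≤ i then r (i - j) else 0 with hρ
  set x : ℕ → ℝ := fun t => if ht : t < T then (Δ ⟨t, ht⟩ : ℝ) else 0 with hxdef
  have hx : ∀ t : Fin T, x t = Δ t := fun t => by simp [hxdef]
  set f : ℕ → ℝ := fun l => ∑ i ∈ Finset.range T, ρ i j * ρ i l with hf
  set P : ℕ → ℝ := fun n => ∑ t ∈ Finset.range n, x t with hPdef
  have hρnn : ∀ i < T, ∀ l, 0 ≤ ρ i l := by
    intro i hi l
    simp only [hρ]
    split_ifs
    · exact hnn _ (by omega)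
    · exact le_rfl
  have key := unimodal_abs f P T j j.2.le D ?_ ?_ ?_ ?_
  · have e1 : ∑ l ∈ Finset.range T, f l * (P (l+1) - P l)
        = ∑ l, (∑ i, R i j * R i l) * (Δ l : ℝ) := by
      rw [Finset.sum_range]
      refine Finset.sum_congr rfl fun l _ => ?_
      rw [← hx l]
      have : P (l+1) - P l = x l := by simp [hPdef, Finset.sum_range_succ]
      rw [this, hf]
      simp only [Finset.sum_range, hR, hρ]
    have e2 : f j = ∑ i, R i j ^ 2 := by
      rw [hf]
      simp only [Finset.sum_range, hR, hρ, sq]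
    rw [← e1, ← e2]
    exact key
  · intro a ha b hb
    rcases le_total a b with hab | hab
    · have := prefix_diff T D Δ h x hx a b hab hb
      rw [abs_sub_comm] at this
      exact (le_abs_self _).trans this
    · exact (le_abs_self _).trans (prefix_diff T D Δ h x hx b a hab ha)
  · intro n
    exact Finset.sum_nonneg fun i hi => mul_nonneg (hρnn i (Finset.mem_range.1 hi) _)
      (hρnn i (Finset.mem_range.1 hi) _)
  · intro n hn
    refine Finset.sum_le_sum fun i hi => ?_
    have hi := Finset.mem_range.1 hi
    by_cases hij : (j : ℕ) ≤ i
    · refine mul_le_mul_of_nonneg_left ?_ (hρnn i hi _)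
      simp only [hρ]
      rw [if_pos (by omega), if_pos (by omega)]
      exact hmono _ _ (by omega) (by omega)
    · simp [hρ, hij]
  · intro n hn
    simp only [hf]
    obtain ⟨S, hS⟩ : ∃ S, T = S + 1 := ⟨T - 1, by have := j.2; omega⟩
    have hsum : ∀ g : ℕ → ℝ, ∑ i ∈ Finset.range T, g i = ∑ i ∈ Finset.range (S+1), g i := by
      intro g
      rw [hS]
    rw [hsum, hsum, Finset.sum_range_succ', Finset.sum_range_succ]
    have h0 : ρ 0 (n+1) = 0 := by simp [hρ]
    rw [h0]
    refine add_le_add (Finset.sum_le_sum fun i hi => ?_) ?_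
    · have hi := Finset.mem_range.1 hi
      have h1 : ρ (i+1) (n+1) = ρ i n := by simp [hρ]
      rw [h1]
      by_cases hin : n ≤ i
      · refine mul_le_mul_of_nonneg_right ?_ (hρnn i (by omega) _)
        simp only [hρ]
        rw [if_pos (by omega), if_pos (by omega)]
        exact hmono _ _ (by omega) (by omega)
      · simp [hρ, hin]
    · rw [mul_zero]
      exact mul_nonneg (hρnn _ (by omega) _) (hρnn _ (by omega) _)

lemma main_bound (T k D : ℕ)
    (r : ℕ → ℝ) (hnn : ∀ t < T, 0 ≤ r t)
    (hmono : ∀ s t : ℕ, s ≤ t → t < T → r t ≤ r s)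
    (R : Matrix (Fin T) (Fin T) ℝ)
    (hR : ∀ i j : Fin T, R i j = if (j : ℕ) ≤ (i : ℕ) then r ((i : ℕ) - (j : ℕ)) else 0)
    (Δ : Fin T → ℤ) (h : Δ ∈ SDk T D k) :
    pnorm 2 (R.mulVec fun t => (Δ t : ℝ)) ≤ Real.sqrt ((k : ℝ) * D) * colNorm2 R := by
  have hC : ∀ j, pnorm 2 (fun i => R i j) ≤ colNorm2 R := fun j =>
    le_csSup (Set.finite_range _).bddAbove ⟨j, rfl⟩
  have hC0 : 0 ≤ colNorm2 R := by
    apply Real.sSup_nonneg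
    rintro _ ⟨j, rfl⟩
    simp only [pnorm_two]
    positivity
  have hC2 : ∀ j, ∑ i, R i j ^ 2 ≤ colNorm2 R ^ 2 := by
    intro j
    have := hC j
    rw [pnorm_two] at this
    exact (Real.sqrt_le_left hC0).1 this
  rw [pnorm_two]
  apply Real.sqrt_le_iff.2
  refine ⟨by positivity, ?_⟩
  rw [mul_pow, Real.sq_sqrt (by positivity)]
  have e : ∑ i, (R.mulVec fun t => (Δ t : ℝ)) i ^ 2
      = ∑ j, (Δ j : ℝ) * ∑ l, (∑ i, R i j * R i l) * (Δ l : ℝ) := by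
    simp only [Matrix.mulVec, dotProduct, sq, Finset.sum_mul_sum, Finset.mul_sum, Finset.sum_mul]
    rw [Finset.sum_comm]
    refine Finset.sum_congr rfl fun j _ => ?_
    rw [Finset.sum_comm]
    refine Finset.sum_congr rfl fun l _ => Finset.sum_congr rfl fun i _ => ?_
    ring
  rw [e]
  have hk : ∑ j, |(Δ j : ℝ)| ≤ (k : ℝ) := by exact_mod_cast h.2
  calc ∑ j, (Δ j : ℝ) * ∑ l, (∑ i, R i j * R i l) * (Δ l : ℝ)
      ≤ ∑ j, |(Δ j : ℝ)| * (colNorm2 R ^ 2 * D) := by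
        refine Finset.sum_le_sum fun j _ => ?_
        refine (le_abs_self _).trans ?_
        rw [abs_mul]
        refine mul_le_mul_of_nonneg_left ?_ (abs_nonneg _)
        refine (gram_bound T D Δ h.1 r hnn hmono R hR j).trans ?_
        exact mul_le_mul_of_nonneg_right (hC2 j) (by positivity)
    _ = (∑ j, |(Δ j : ℝ)|) * (colNorm2 R ^ 2 * D) := by rw [Finset.sum_mul]
    _ ≤ k * (colNorm2 R ^ 2 * D) := mul_le_mul_of_nonneg_right hk (by positivity)
    _ = k * D * colNorm2 R ^ 2 := by ring

theorem stmt7 (T k D : ℕ) (hT : 1 ≤ T) (hk : 1 ≤ k) (hD : 1 ≤ D)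
    (r : ℕ → ℝ) (hnn : ∀ t < T, 0 ≤ r t)
    (hmono : ∀ s t : ℕ, s ≤ t → t < T → r t ≤ r s)
    (R : Matrix (Fin T) (Fin T) ℝ)
    (hR : ∀ i j : Fin T, R i j = if (j : ℕ) ≤ (i : ℕ) then r ((i : ℕ) - (j : ℕ)) else 0) :
    (∀ Δ ∈ SDk T D k,
        pnorm 2 (R.mulVec fun t => (Δ t : ℝ)) ≤ Real.sqrt ((k : ℝ) * D) * colNorm2 R) ∧
      sens 2 R (SDk T D k) ≤ Real.sqrt ((k : ℝ) * D) * colNorm2 R := by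
  have hmain := main_bound T k D r hnn hmono R hR
  refine ⟨hmain, ?_⟩
  unfold sens
  refine csSup_le ⟨_, 0, ?_, rfl⟩ ?_
  · constructor
    · intro i j _
      simp
    · simp
  · rintro _ ⟨Δ, h, rfl⟩
    exact hmain Δ h
end

section
/- Let T ≥ 1 be an integer, let √A ∈ ℝ^{T×T} be the square-root matrix, and define c(i,j) = ((√A)ᵀ (√A))[i,j] for i,j ∈ {0,…,T−1}. Then for all i ≠ j, c(i,j) ≤ (1/π)·ln(1 + T/|i−j|) + 3/2. -/
open Matrix

/-- The coefficients of the square-root matrix. -/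
noncomputable def qc (t : ℕ) : ℝ := (Nat.choose (2 * t) t : ℝ) / 4 ^ t

lemma qc_nonneg (t : ℕ) : 0 ≤ qc t := by unfold qc; positivity

lemma qc_sq (t : ℕ) : (qc t) ^ 2 * (Real.pi * t) ≤ 1 := by
  have h1 := Real.Wallis.le_W t
  rw [Real.Wallis.W_eq_factorial_ratio] at h1
  have h2 : (Nat.choose (2 * t) t : ℝ) = (2 * t).factorial / (t.factorial * t.factorial) := by
    rw [Nat.cast_choose ℝ (by omega)]
    congr 3
    congr 1
    omega
  have hf : (0 : ℝ) < (2 * t).factorial := by positivity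
  have hg : (0 : ℝ) < t.factorial := by positivity
  have h3 : (2 : ℝ) ^ (4 * t) * t.factorial ^ 4 / ((2 * t).factorial ^ 2 * (2 * t + 1)) * (2 * t + 1) * qc t ^ 2 = 1 := by
    unfold qc
    rw [h2]
    have : (2 : ℝ) ^ (4 * t) = (4 ^ t) ^ 2 := by
      rw [← pow_mul, mul_comm t 2, pow_mul, pow_mul]; norm_num
    rw [this]
    field_simp
  have hp := Real.pi_pos
  have ht : (0 : ℝ) ≤ t := Nat.cast_nonneg t
  have h4 : Real.pi * t ≤ (2 * (t : ℝ) + 1) / (2 * t + 2) * (Real.pi / 2) * (2 * t + 1) := by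
    have : (2 * (t : ℝ) + 1) / (2 * t + 2) * (Real.pi / 2) * (2 * t + 1) - Real.pi * t
        = Real.pi / (2 * (2 * t + 2)) := by field_simp; ring
    have h5 : 0 ≤ Real.pi / (2 * (2 * (t : ℝ) + 2)) := by positivity
    linarith
  have h6 := h4.trans (mul_le_mul_of_nonneg_right h1 (by positivity : (0 : ℝ) ≤ 2 * t + 1))
  have h7 := mul_le_mul_of_nonneg_right h6 (sq_nonneg (qc t))
  rw [h3] at h7
  linarith

lemma qc_le (t : ℕ) : qc t * (√Real.pi * √t) ≤ 1 := by
  have h := qc_sq t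
  have hn := qc_nonneg t
  have h1 : (qc t * (√Real.pi * √t)) ^ 2 ≤ 1 ^ 2 := by
    rw [mul_pow, mul_pow, Real.sq_sqrt Real.pi_pos.le, Real.sq_sqrt (Nat.cast_nonneg t)]
    simpa using h
  exact abs_le_of_sq_le_sq' h1 (by norm_num) |>.2

/-- Product bound. -/
lemma qc_prod (s t m : ℕ) (hs : 1 ≤ s) (hm : 1 ≤ m) (hmt : m ≤ t) :
    Real.pi * (qc s * qc t) ≤ 1 / (√s * √m) := by
  have hs' : (0 : ℝ) < √s := Real.sqrt_pos.2 (by exact_mod_cast hs)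
  have hm' : (0 : ℝ) < √m := Real.sqrt_pos.2 (by exact_mod_cast hm)
  have hmt' : √(m : ℝ) ≤ √t := Real.sqrt_le_sqrt (by exact_mod_cast hmt)
  have hp : 0 < √Real.pi := Real.sqrt_pos.2 Real.pi_pos
  rw [le_div_iff₀ (by positivity)]
  have h1 := qc_le s
  have h2 := qc_le t
  have n1 := qc_nonneg s
  have n2 := qc_nonneg t
  have h3 : qc t * (√Real.pi * √m) ≤ 1 := le_trans (by gcongr) h2
  calc Real.pi * (qc s * qc t) * (√s * √m)
      = (√Real.pi * √Real.pi) * (qc s * qc t) * (√s * √m) := by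
        rw [Real.mul_self_sqrt Real.pi_pos.le]
    _ = (qc s * (√Real.pi * √s)) * (qc t * (√Real.pi * √m)) := by ring
    _ ≤ 1 := mul_le_one₀ h1 (by positivity) h3

lemma sum_small (d : ℕ) (hd : 1 ≤ d) (n : ℕ) :
    ∑ t ∈ Finset.range n, Real.pi * (qc (t + 1) * qc (t + 1 + d)) ≤ 2 * √n / √d := by
  induction n with
  | zero => simp
  | succ n ih =>
    rw [Finset.sum_range_succ]
    have h := qc_prod (n + 1) (n + 1 + d) d (by omega) hd (by omega)
    have hd' : (0 : ℝ) < √d := Real.sqrt_pos.2 (by exact_mod_cast hd)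
    have hs' : (0 : ℝ) < √((n + 1 : ℕ) : ℝ) := Real.sqrt_pos.2 (by positivity)
    have e1 : √((n + 1 : ℕ) : ℝ) ^ 2 = n + 1 := by
      rw [Real.sq_sqrt (by positivity)]; push_cast; ring
    have e2 : √(n : ℝ) ^ 2 = n := Real.sq_sqrt (by positivity)
    have k : 1 / √((n + 1 : ℕ) : ℝ) ≤ 2 * √((n + 1 : ℕ) : ℝ) - 2 * √n := by
      rw [div_le_iff₀ hs']
      nlinarith [sq_nonneg (√((n + 1 : ℕ) : ℝ) - √n)]
    have k2 : 1 / (√((n + 1 : ℕ) : ℝ) * √d) ≤ (2 * √((n + 1 : ℕ) : ℝ) - 2 * √n) / √d := by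
      rw [← div_div]; gcongr
    rw [sub_div] at k2
    linarith

lemma sum_large (d : ℕ) (hd : 1 ≤ d) (m : ℕ) :
    ∑ t ∈ Finset.range (d + m), Real.pi * (qc (t + 1) * qc (t + 1 + d))
      ≤ 2 + Real.log (((d + m : ℕ) : ℝ) / d) := by
  have hd0 : (0 : ℝ) < d := by exact_mod_cast hd
  induction m with
  | zero =>
    have h := sum_small d hd d
    have hd' : (0 : ℝ) < √d := Real.sqrt_pos.2 hd0
    rw [mul_div_assoc, div_self hd'.ne'] at h
    simp only [add_zero, div_self hd0.ne', Real.log_one]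
    linarith
  | succ m ih =>
    rw [← add_assoc, Finset.sum_range_succ]
    have h := qc_prod (d + m + 1) (d + m + 1 + d) (d + m + 1) (by omega) (by omega) (by omega)
    rw [Real.mul_self_sqrt (by positivity)] at h
    have hp : (0 : ℝ) < ((d + m : ℕ) : ℝ) := by exact_mod_cast (by omega : 0 < d + m)
    have hp1 : (0 : ℝ) < ((d + m + 1 : ℕ) : ℝ) := by positivity
    have hl := Real.one_sub_inv_le_log_of_pos (div_pos hp1 hp)
    have e : 1 - (((d + m + 1 : ℕ) : ℝ) / ((d + m : ℕ) : ℝ))⁻¹ = 1 / ((d + m + 1 : ℕ) : ℝ) := by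
      rw [inv_div]
      field_simp
      push_cast
      ring
    rw [e, Real.log_div hp1.ne' hp.ne'] at hl
    rw [Real.log_div hp1.ne' hd0.ne']
    rw [Real.log_div hp.ne' hd0.ne'] at ih
    linarith

lemma sum_bound (d : ℕ) (hd : 1 ≤ d) (n T : ℕ) (hn : n ≤ T) :
    ∑ t ∈ Finset.range n, Real.pi * (qc (t + 1) * qc (t + 1 + d))
      ≤ 2 + Real.log (1 + (T : ℝ) / d) := by
  have hd0 : (0 : ℝ) < d := by exact_mod_cast hd
  rcases le_total n d with h | h
  · have h1 := sum_small d hd n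
    have h2 : √(n : ℝ) ≤ √d := Real.sqrt_le_sqrt (by exact_mod_cast h)
    have hd' : (0 : ℝ) < √d := Real.sqrt_pos.2 hd0
    have h3 : 2 * √(n : ℝ) / √d ≤ 2 := by rw [div_le_iff₀ hd']; linarith
    have h4 : 0 ≤ Real.log (1 + (T : ℝ) / d) :=
      Real.log_nonneg (by have : 0 ≤ (T : ℝ) / d := by positivity
                          linarith)
    linarith
  · obtain ⟨m, rfl⟩ := Nat.exists_eq_add_of_le h
    refine (sum_large d hd m).trans ?_
    have hp : (0 : ℝ) < ((d + m : ℕ) : ℝ) := by exact_mod_cast (by omega : 0 < d + m)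
    have h1 : ((d + m : ℕ) : ℝ) / d ≤ (T : ℝ) / d := by
      gcongr
    have := Real.log_le_log (div_pos hp hd0) (by linarith : ((d + m : ℕ) : ℝ) / d ≤ 1 + (T : ℝ) / d)
    linarith

lemma total_bound (d : ℕ) (hd : 1 ≤ d) (n T : ℕ) (hn : n ≤ T) :
    ∑ t ∈ Finset.range (n + 1), qc t * qc (t + d)
      ≤ (1 / Real.pi) * Real.log (1 + (T : ℝ) / d) + 3 / 2 := by
  rw [Finset.sum_range_succ']
  have h := sum_bound d hd n T hn
  rw [← Finset.mul_sum] at h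
  have q0 : qc 0 = 1 := by simp [qc]
  have hp := Real.pi_gt_three
  have h1 : qc d ≤ 4 / 5 := by
    have a := qc_sq d
    have b := qc_nonneg d
    have c : (1 : ℝ) ≤ d := by exact_mod_cast hd
    have e : 3 ≤ Real.pi * d := by nlinarith
    by_contra hc
    push Not at hc
    nlinarith [mul_le_mul_of_nonneg_left e (sq_nonneg (qc d))]
  rw [q0, zero_add, one_mul]
  have h2 : ∑ t ∈ Finset.range n, qc (t + 1) * qc (t + 1 + d)
      ≤ (2 + Real.log (1 + (T : ℝ) / d)) / Real.pi := by
    rw [le_div_iff₀ (by linarith)]; linarith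
  have h3 : 2 / Real.pi ≤ 2 / 3 := by gcongr
  rw [add_div] at h2
  rw [one_div_mul_eq_div]
  linarith

lemma main_lt (T : ℕ) (R : Matrix (Fin T) (Fin T) ℝ)
    (hR : ∀ i j : Fin T, R i j = if (j : ℕ) ≤ (i : ℕ) then qc ((i : ℕ) - (j : ℕ)) else 0)
    (i j : Fin T) (hij : (i : ℕ) < j) :
    (Rᵀ * R) i j ≤
      (1 / Real.pi) * Real.log (1 + (T : ℝ) / |((i : ℕ) : ℝ) - ((j : ℕ) : ℝ)|) + 3 / 2 := by
  obtain ⟨i, hi⟩ := i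
  obtain ⟨j, hj⟩ := j
  simp only at hij ⊢
  obtain ⟨d, rfl⟩ := Nat.exists_eq_add_of_lt hij
  obtain ⟨n, hn⟩ := Nat.exists_eq_add_of_lt hj
  have hab : |(i : ℝ) - ((i + d + 1 : ℕ) : ℝ)| = ((d + 1 : ℕ) : ℝ) := by
    rw [abs_sub_comm]; push_cast
    rw [abs_of_nonneg] <;> [ring; (ring_nf; positivity)]
  rw [hab]
  refine le_trans (le_of_eq ?_) (total_bound (d + 1) (by omega) n T (by omega))
  rw [Matrix.mul_apply]
  simp only [Matrix.transpose_apply, hR]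
  rw [Fin.sum_univ_eq_sum_range (fun k => (if i ≤ k then qc (k - i) else 0) *
    (if i + d + 1 ≤ k then qc (k - (i + d + 1)) else 0)) T]
  rw [show T = (i + d + 1) + (n + 1) by omega, Finset.sum_range_add, Finset.sum_eq_zero, zero_add]
  · refine Finset.sum_congr rfl fun x _ => ?_
    rw [if_pos (by omega), if_pos (by omega), mul_comm]
    congr 2 <;> omega
  · intro x hx
    rw [Finset.mem_range] at hx
    rw [if_neg (show ¬ (i + d + 1 ≤ x) by omega), mul_zero]

theorem stmt8 (T : ℕ) (hT : 1 ≤ T) (R : Matrix (Fin T) (Fin T) ℝ)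
    (hR : ∀ i j : Fin T, R i j =
      if (j : ℕ) ≤ (i : ℕ) then
        (Nat.choose (2 * ((i : ℕ) - (j : ℕ))) ((i : ℕ) - (j : ℕ)) : ℝ) / 4 ^ ((i : ℕ) - (j : ℕ))
      else 0)
    (i j : Fin T) (hij : i ≠ j) :
    (Rᵀ * R) i j ≤
      (1 / Real.pi) * Real.log (1 + (T : ℝ) / |((i : ℕ) : ℝ) - ((j : ℕ) : ℝ)|) + 3 / 2 := by
  rcases lt_or_gt_of_ne (fun h => hij (Fin.ext h) : (i : ℕ) ≠ j) with h | h
  · exact main_lt T R hR i j h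
  · have := main_lt T R hR j i h
    rw [abs_sub_comm]
    refine le_trans (le_of_eq ?_) this
    rw [Matrix.mul_apply, Matrix.mul_apply]
    exact Finset.sum_congr rfl fun k _ => by simp only [Matrix.transpose_apply]; ring
end

section
/- Let 1 ≤ D ≤ k ≤ T be integers, let p ≥ 1 be real, and let A ∈ ℝ^{T×T} be the lower-triangular all-ones matrix. Then sens_p(A, S_{D,k})^p = D^p · T; equivalently, sens_p(A, S_{D,k}) = D · T^{1/p}. -/
theorem stmt10 (T D k : ℕ) (hD : 1 ≤ D) (hDk : D ≤ k) (hkT : k ≤ T)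
    (p : ℝ) (hp : 1 ≤ p)
    (A : Matrix (Fin T) (Fin T) ℝ)
    (hA : ∀ i j : Fin T, A i j = if (j : ℕ) ≤ (i : ℕ) then 1 else 0) :
    sens p A (SDk T D k) ^ p = (D : ℝ) ^ p * (T : ℝ) ∧
      sens p A (SDk T D k) = (D : ℝ) * (T : ℝ) ^ (1 / p) := by
  have hp0 : 0 < p := by linarith
  have hT : 0 < T := by omega
  have key : sens p A (SDk T D k) = (D : ℝ) * (T : ℝ) ^ (1 / p) := by
    have hval : ((∑ _i : Fin T, (D : ℝ) ^ p) ^ (1 / p)) = (D : ℝ) * (T : ℝ) ^ (1 / p) := by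
      rw [Finset.sum_const, Finset.card_univ, Fintype.card_fin, nsmul_eq_mul,
        Real.mul_rpow (by positivity) (by positivity), ← Real.rpow_mul (by positivity),
        mul_one_div_cancel hp0.ne', Real.rpow_one, mul_comm]
    have hmv : ∀ (Δ : Fin T → ℤ) (i : Fin T), A.mulVec (fun t => (Δ t : ℝ)) i
        = ((∑ t ∈ Finset.Icc (⟨0, hT⟩ : Fin T) i, Δ t : ℤ) : ℝ) := by
      intro Δ i
      have hI : Finset.Icc (⟨0, hT⟩ : Fin T) i
          = Finset.univ.filter (fun j : Fin T => (j : ℕ) ≤ (i : ℕ)) := by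
        ext j
        simp only [Finset.mem_Icc, Finset.mem_filter, Finset.mem_univ, true_and, Fin.le_def]
        omega
      rw [hI, Finset.sum_filter]
      simp only [Matrix.mulVec, dotProduct, hA]
      push_cast
      exact Finset.sum_congr rfl fun j _ => by split_ifs <;> simp
    have hG : IsGreatest ((fun Δ => pnorm p (A.mulVec fun t => (Δ t : ℝ))) '' SDk T D k)
        ((D : ℝ) * (T : ℝ) ^ (1 / p)) := by
      constructor
      · refine ⟨Pi.single ⟨0, hT⟩ (D : ℤ), ⟨?_, ?_⟩, ?_⟩
        · intro i j hij
          rw [Finset.sum_pi_single']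
          split_ifs <;> simp
        · have : ∀ t : Fin T, |(Pi.single ⟨0, hT⟩ (D : ℤ) : Fin T → ℤ) t|
              = (Pi.single ⟨0, hT⟩ (D : ℤ) : Fin T → ℤ) t := by
            intro t
            rw [Pi.single_apply]
            split_ifs <;> simp
          simp only [this, Finset.sum_pi_single', Finset.mem_univ, if_true]
          exact_mod_cast hDk
        · simp only [pnorm]
          rw [← hval]
          congr 1
          refine Finset.sum_congr rfl fun i _ => ?_
          rw [hmv, Finset.sum_pi_single', if_pos (Finset.mem_Icc.2 ⟨le_refl _, Fin.mk_le_of_le_val (Nat.zero_le _)⟩)]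
          simp
      · rintro _ ⟨Δ, ⟨hS, -⟩, rfl⟩
        simp only [pnorm]
        rw [← hval]
        refine Real.rpow_le_rpow (Finset.sum_nonneg fun i _ => by positivity) ?_ (by positivity)
        refine Finset.sum_le_sum fun i _ => ?_
        refine Real.rpow_le_rpow (abs_nonneg _) ?_ hp0.le
        rw [hmv]
        have := hS ⟨0, hT⟩ i (Nat.zero_le _)
        exact_mod_cast this
    exact hG.csSup_eq
  refine ⟨?_, key⟩
  rw [key, Real.mul_rpow (by positivity) (by positivity), ← Real.rpow_mul (by positivity),
    one_div_mul_cancel hp0.ne', Real.rpow_one]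
end

section
/- Let b ≥ 2 and h ≥ 1 be integers, T = b^h, let 0 ≤ k ≤ b^h, and let p ≥ 1 be real. Then sens_p(R_b, S_{1,k})^p = max_{0 ≤ k' ≤ k} F_b(h, k'). -/
/-- Nodes `(ℓ, j)` of the complete `b`-ary tree of height `h`:
`0 ≤ ℓ ≤ h` and `0 ≤ j ≤ b^(h-ℓ) - 1`. -/
def treeNodes (b h : ℕ) : Finset (ℕ × ℕ) :=
  (Finset.range (h + 1) ×ˢ Finset.range (b ^ h)).filter fun q => q.2 < b ^ (h - q.1)

/-- The leaf interval `v_{ℓ,j} = {j·b^ℓ, …, (j+1)·b^ℓ − 1}` of node `q = (ℓ, j)`. -/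
def iv (b : ℕ) (q : ℕ × ℕ) : Finset ℕ :=
  Finset.Ico (q.2 * b ^ q.1) ((q.2 + 1) * b ^ q.1)

/-- The number of nodes of the complete `b`-ary tree of height `h` whose subtree
contains an odd number of elements of `B`. -/
def oddCount (b h : ℕ) (B : Finset ℕ) : ℕ :=
  ((treeNodes b h).filter fun q => Odd (B ∩ iv b q).card).card

/-- `F_b(h, k)`: the maximum number of odd nodes over all placements of `k` balls
on the leaves of the complete `b`-ary tree of height `h`. -/
def Fb (b h k : ℕ) : ℕ :=
  ((Finset.range (b ^ h)).powersetCard k).sup fun B => oddCount b h B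

/-- The matrix `R_b` of the complete `b`-ary tree of height `h`: rows are indexed
by node coordinates `(ℓ, j)` (rows whose coordinates do not correspond to a tree
node are identically zero), columns by leaves, and entry `1` iff the leaf lies
in the node's subtree. -/
def nodeMatrix (b h : ℕ) : Matrix (Fin (h + 1) × Fin (b ^ h)) (Fin (b ^ h)) ℝ :=
  fun q t =>
    if (q.2 : ℕ) * b ^ (q.1 : ℕ) ≤ (t : ℕ) ∧ (t : ℕ) < ((q.2 : ℕ) + 1) * b ^ (q.1 : ℕ) then 1
    else 0

/-- Support of `Δ` as a set of naturals. -/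
def supp {T : ℕ} (Δ : Fin T → ℤ) : Finset ℕ :=
  (Finset.univ.filter fun t => Δ t ≠ 0).map Fin.valEmbedding

lemma supp_subset {T : ℕ} (Δ : Fin T → ℤ) : supp Δ ⊆ Finset.range T := by
  intro x hx
  simp only [supp, Finset.mem_map, Finset.mem_filter, Finset.mem_univ, true_and,
    Fin.valEmbedding_apply] at hx
  obtain ⟨a, _, rfl⟩ := hx
  simp

lemma abs_le_one_of_memS {T : ℕ} {Δ : Fin T → ℤ} (hΔ : memS T 1 Δ) (t : Fin T) : |Δ t| ≤ 1 := by
  have := hΔ t t le_rfl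
  simpa using this

lemma filter_sum_le {T : ℕ} {Δ : Fin T → ℤ} (hΔ : memS T 1 Δ) (a c : ℕ) :
    |∑ t ∈ Finset.univ.filter (fun t : Fin T => a ≤ (t : ℕ) ∧ (t : ℕ) < c), Δ t| ≤ 1 := by
  by_cases hac : a < c ∧ a < T
  · have h1 : min (c - 1) (T - 1) < T := by omega
    have := hΔ ⟨a, hac.2⟩ ⟨min (c - 1) (T - 1), h1⟩ (by rw [Fin.mk_le_mk]; omega)
    have he : (Finset.univ.filter fun t : Fin T => (a ≤ (t : ℕ) ∧ (t : ℕ) < c))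
        = Finset.Icc ⟨a, hac.2⟩ ⟨min (c - 1) (T - 1), h1⟩ := by
      ext t
      have := t.2
      simp only [Finset.mem_filter, Finset.mem_univ, true_and, Finset.mem_Icc, Fin.le_def]
      omega
    rw [he]
    simpa using this
  · have he : (Finset.univ.filter fun t : Fin T => (a ≤ (t : ℕ) ∧ (t : ℕ) < c)) = ∅ := by
      ext t
      have := t.2
      simp only [Finset.mem_filter, Finset.mem_univ, true_and, Finset.notMem_empty, iff_false]
      omega
    rw [he]; simp

lemma sum_abs_eq {T : ℕ} {Δ : Fin T → ℤ} (hΔ : memS T 1 Δ) (s : Finset (Fin T)) :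
    ∑ t ∈ s, |Δ t| = ((s.filter fun t => Δ t ≠ 0).card : ℤ) := by
  rw [Finset.card_filter]
  push_cast
  refine Finset.sum_congr rfl fun t _ => ?_
  have := abs_le_one_of_memS hΔ t
  split_ifs with h
  · have := abs_pos.mpr h
    omega
  · simp at h; simp [h]

lemma parity_sum {T : ℕ} (Δ : Fin T → ℤ) (s : Finset (Fin T)) :
    Odd (∑ t ∈ s, Δ t) ↔ Odd (∑ t ∈ s, |Δ t|) := by
  induction s using Finset.induction_on with
  | empty => simp
  | insert a s ha ih =>
    rw [Finset.sum_insert ha, Finset.sum_insert ha, Int.odd_add, Int.odd_add, odd_abs,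
      ← Int.not_odd_iff_even, ← Int.not_odd_iff_even, ih]

lemma row_abs {T : ℕ} {Δ : Fin T → ℤ} (hΔ : memS T 1 Δ) (a c : ℕ) :
    |∑ t ∈ Finset.univ.filter (fun t : Fin T => a ≤ (t : ℕ) ∧ (t : ℕ) < c), Δ t|
      = if Odd (supp Δ ∩ Finset.Ico a c).card then 1 else 0 := by
  have h1 := filter_sum_le hΔ a c
  have h2 := parity_sum Δ (Finset.univ.filter fun t : Fin T => (a ≤ (t : ℕ) ∧ (t : ℕ) < c))
  rw [sum_abs_eq hΔ] at h2
  have h3 : (supp Δ ∩ Finset.Ico a c) = ((Finset.univ.filter fun t : Fin T =>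
      (a ≤ (t : ℕ) ∧ (t : ℕ) < c)).filter fun t => Δ t ≠ 0).map Fin.valEmbedding := by
    ext x
    simp only [supp, Finset.mem_inter, Finset.mem_map, Finset.mem_filter, Finset.mem_univ,
      true_and, Fin.valEmbedding_apply, Finset.mem_Ico]
    constructor
    · rintro ⟨⟨t, h, rfl⟩, h'⟩
      exact ⟨t, ⟨h', h⟩, rfl⟩
    · rintro ⟨t, ⟨h', h⟩, rfl⟩
      exact ⟨⟨t, h, rfl⟩, h'⟩
  rw [h3, Finset.card_map]
  rw [Int.odd_coe_nat] at h2
  simp only [← h2]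
  generalize (∑ t ∈ Finset.univ.filter (fun t : Fin T => a ≤ (t : ℕ) ∧ (t : ℕ) < c), Δ t) = x at h1 ⊢
  have : x = -1 ∨ x = 0 ∨ x = 1 := by rw [abs_le] at h1; omega
  rcases this with rfl | rfl | rfl <;> decide

lemma key1 (b h : ℕ) (p : ℝ) (hp : 1 ≤ p) (hb : 2 ≤ b) {Δ : Fin (b ^ h) → ℤ}
    (hΔ : memS (b ^ h) 1 Δ) :
    ∑ q, |(nodeMatrix b h).mulVec (fun t => (Δ t : ℝ)) q| ^ p = (oddCount b h (supp Δ) : ℝ) := by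
  have hrow : ∀ q : Fin (h + 1) × Fin (b ^ h),
      |(nodeMatrix b h).mulVec (fun t => (Δ t : ℝ)) q| ^ p
        = (fun q : ℕ × ℕ => if Odd (supp Δ ∩ iv b q).card then (1 : ℝ) else 0)
          ((q.1 : ℕ), (q.2 : ℕ)) := by
    intro q
    have h0 : (nodeMatrix b h).mulVec (fun t => (Δ t : ℝ)) q
        = ((∑ t ∈ Finset.univ.filter (fun t : Fin (b ^ h) => (q.2 : ℕ) * b ^ (q.1 : ℕ) ≤ (t : ℕ) ∧
            (t : ℕ) < ((q.2 : ℕ) + 1) * b ^ (q.1 : ℕ)), Δ t : ℤ) : ℝ) := by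
      simp only [Matrix.mulVec, dotProduct, nodeMatrix, ite_mul, one_mul, zero_mul]
      rw [Finset.sum_filter]
      push_cast
      rfl
    rw [h0, ← Int.cast_abs, row_abs hΔ]
    change (((if Odd (supp Δ ∩ iv b ((q.1 : ℕ), (q.2 : ℕ))).card then 1 else 0 : ℤ)) : ℝ) ^ p
      = if Odd (supp Δ ∩ iv b ((q.1 : ℕ), (q.2 : ℕ))).card then (1 : ℝ) else 0
    by_cases ho : Odd (supp Δ ∩ iv b ((q.1 : ℕ), (q.2 : ℕ))).card
    · rw [if_pos ho, if_pos ho]; simp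
    · rw [if_neg ho, if_neg ho, Int.cast_zero]
      exact Real.zero_rpow (by linarith)
  rw [Finset.sum_congr rfl fun q _ => hrow q]
  rw [Fintype.sum_prod_type]
  rw [Fin.sum_univ_eq_sum_range (fun l => ∑ y : Fin (b ^ h),
    (fun q : ℕ × ℕ => if Odd (supp Δ ∩ iv b q).card then (1 : ℝ) else 0) (l, (y : ℕ))) (h + 1)]
  simp_rw [fun l : ℕ => Fin.sum_univ_eq_sum_range (fun y =>
    if Odd (supp Δ ∩ iv b (l, y)).card then (1 : ℝ) else 0) (b ^ h)]
  rw [← Finset.sum_product' (Finset.range (h + 1)) (Finset.range (b ^ h))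
    (fun l y => if Odd (supp Δ ∩ iv b (l, y)).card then (1 : ℝ) else 0)]
  rw [oddCount, Finset.card_filter, treeNodes]
  push_cast
  symm
  apply Finset.sum_subset (Finset.filter_subset _ _)
  intro q hq hq'
  simp only [Finset.mem_filter, hq, true_and, not_lt] at hq'
  rw [if_neg]
  have : supp Δ ∩ iv b q = ∅ := by
    ext x
    simp only [Finset.mem_inter, Finset.notMem_empty, iff_false, iv, Finset.mem_Ico]
    rintro ⟨hx, hx2, _⟩
    have hx := Finset.mem_range.mp (supp_subset Δ hx)
    have hl : q.1 ≤ h := by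
      have := (Finset.mem_product.mp hq).1
      simp at this; omega
    have : b ^ h ≤ q.2 * b ^ q.1 := by
      calc b ^ h = b ^ (h - q.1) * b ^ q.1 := by rw [← pow_add]; congr 1; omega
        _ ≤ _ := Nat.mul_le_mul_right _ hq'
    omega
  rw [this]; simp

lemma key2 (T : ℕ) (B : Finset ℕ) (hB : B ⊆ Finset.range T) :
    ∃ Δ : Fin T → ℤ, memS T 1 Δ ∧ supp Δ = B := by
  let f : ℕ → ℤ := fun n => (((B.filter fun x => x < n).card % 2 : ℕ) : ℤ)
  have hf : ∀ n, f n = 0 ∨ f n = 1 := by intro n; simp only [f]; omega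
  have hstep : ∀ n, f (n + 1) - f n ≠ 0 ↔ n ∈ B := by
    intro n
    by_cases hn : n ∈ B
    · have : (B.filter fun x => x < n + 1) = insert n (B.filter fun x => x < n) := by
        ext x; simp only [Finset.mem_filter, Finset.mem_insert]
        grind
      simp only [f, this, hn, iff_true]
      rw [Finset.card_insert_of_notMem (by simp)]
      omega
    · have : (B.filter fun x => x < n + 1) = (B.filter fun x => x < n) := by
        ext x; simp only [Finset.mem_filter]
        grind
      simp only [f, this, sub_self, ne_eq, not_true_eq_false, hn]
  refine ⟨fun t => f (t + 1) - f t, ?_, ?_⟩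
  · intro i j hij
    have : ∑ t ∈ Finset.Icc i j, (f ((t : ℕ) + 1) - f t) = f (j + 1) - f i := by
      rw [← Finset.sum_Ico_sub f (show (i : ℕ) ≤ j + 1 by rw [Fin.le_def] at hij; omega)]
      have hm : Finset.Ico (i : ℕ) (j + 1) = (Finset.Icc i j).map Fin.valEmbedding := by
        rw [Fin.map_valEmbedding_Icc]; ext; simp
      rw [hm, Finset.sum_map]
      rfl
    rw [this, abs_le]
    have := hf (j + 1)
    have := hf i
    push_cast
    omega
  · ext x
    simp only [supp, Finset.mem_map, Finset.mem_filter, Finset.mem_univ, true_and,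
      Fin.valEmbedding_apply, hstep]
    constructor
    · rintro ⟨t, h, rfl⟩; exact h
    · intro h
      exact ⟨⟨x, Finset.mem_range.mp (hB h)⟩, h, rfl⟩

lemma supp_card {T : ℕ} {Δ : Fin T → ℤ} (hΔ : memS T 1 Δ) :
    ∑ t, |Δ t| = ((supp Δ).card : ℤ) := by
  rw [sum_abs_eq hΔ, supp, Finset.card_map]

theorem stmt11 (b h k : ℕ) (hb : 2 ≤ b) (hh : 1 ≤ h) (hk : k ≤ b ^ h)
    (p : ℝ) (hp : 1 ≤ p) :
    sens p (nodeMatrix b h) (SDk (b ^ h) 1 k) ^ p =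
      ((((Finset.range (k + 1)).sup fun k' => Fb b h k') : ℕ) : ℝ) := by
  set M := (Finset.range (k + 1)).sup fun k' => Fb b h k' with hM
  have hg : IsGreatest ((fun Δ => pnorm p ((nodeMatrix b h).mulVec fun t => (Δ t : ℝ))) ''
      (SDk (b ^ h) 1 k)) ((M : ℝ) ^ (1 / p)) := by
    constructor
    · obtain ⟨k', hk', e1⟩ := Finset.exists_mem_eq_sup (Finset.range (k + 1)) (by simp)
        (fun k' => Fb b h k')
      have hk'' : k' ≤ k := by simp at hk'; omega
      obtain ⟨B, hB, e2⟩ := Finset.exists_mem_eq_sup ((Finset.range (b ^ h)).powersetCard k')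
        (Finset.powersetCard_nonempty.mpr (by simp; omega)) (fun B => oddCount b h B)
      rw [Finset.mem_powersetCard] at hB
      obtain ⟨Δ, h1, h2⟩ := key2 (b ^ h) B hB.1
      refine ⟨Δ, ⟨h1, ?_⟩, ?_⟩
      · rw [supp_card h1, h2, hB.2]; exact_mod_cast hk''
      · simp only [pnorm]
        rw [key1 b h p hp hb h1, h2, hM, e1, Fb, e2]
    · rintro _ ⟨Δ, ⟨h1, h2⟩, rfl⟩
      simp only [pnorm]
      rw [key1 b h p hp hb h1]
      rw [supp_card h1] at h2
      have h2 : (supp Δ).card ≤ k := by exact_mod_cast h2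
      have h3 : oddCount b h (supp Δ) ≤ Fb b h (supp Δ).card :=
        Finset.le_sup (f := fun B => oddCount b h B)
          (Finset.mem_powersetCard.mpr ⟨supp_subset Δ, rfl⟩)
      have h4 : Fb b h (supp Δ).card ≤ M :=
        Finset.le_sup (f := fun k' => Fb b h k') (by simp; omega)
      apply Real.rpow_le_rpow (by positivity) (by exact_mod_cast h3.trans h4)
      positivity
  rw [sens, hg.csSup_eq, ← Real.rpow_mul (by positivity), one_div_mul_cancel (by linarith),
    Real.rpow_one]
end

section
/- Let b ≥ 2 be an integer. For all integers h ≥ 1 and 0 ≤ k ≤ b^h, F_b(h, k) = 1_{[k odd]} + max{ Σ_{i=1}^{b} F_b(h−1, k_i) : k_1, …, k_b non-negative integers with k_1 + … + k_b = k and k_i ≤ b^{h−1} for all i }, where 1_{[k odd]} equals 1 if k is odd and 0 otherwise; moreover F_b(0, k) = k for k ∈ {0,1}. -/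
lemma sum_range_block (a n : ℕ) (f : ℕ → ℕ) :
    ∑ x ∈ Finset.range (a * n), f x
      = ∑ i ∈ Finset.range a, ∑ y ∈ Finset.range n, f (i * n + y) := by
  induction a with
  | zero => simp
  | succ a ih => rw [Nat.succ_mul, Finset.sum_range_add, ih, Finset.sum_range_succ]

/-- The part of `B` in the `i`-th block of length `n`, shifted to start at zero. -/
def slice (n : ℕ) (B : Finset ℕ) (i : ℕ) : Finset ℕ :=
  (Finset.range n).filter fun x => i * n + x ∈ B

lemma oddCount_eq (b h : ℕ) (hb : 2 ≤ b) (B : Finset ℕ) :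
    oddCount b h B = ∑ l ∈ Finset.range (h + 1), ∑ j ∈ Finset.range (b ^ (h - l)),
      if Odd (B ∩ iv b (l, j)).card then 1 else 0 := by
  unfold oddCount treeNodes
  rw [Finset.card_filter, Finset.sum_filter, Finset.sum_product]
  refine Finset.sum_congr rfl fun l _ => ?_
  rw [← Finset.sum_filter]
  refine Finset.sum_congr ?_ fun _ _ => rfl
  ext j
  have : b ^ (h - l) ≤ b ^ h := Nat.pow_le_pow_right (by omega) (by omega)
  simp only [Finset.mem_filter, Finset.mem_range]
  omega

lemma card_slice_inter (b h l i j : ℕ) (hl : l ≤ h) (hj : j < b ^ (h - l)) (B : Finset ℕ) :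
    (slice (b ^ h) B i ∩ iv b (l, j)).card = (B ∩ iv b (l, i * b ^ (h - l) + j)).card := by
  have e : b ^ h = b ^ (h - l) * b ^ l := by rw [← pow_add]; congr 1; omega
  have e1 : (i * b ^ (h - l) + j) * b ^ l = i * b ^ h + j * b ^ l := by rw [e]; ring
  have e2 : (i * b ^ (h - l) + j + 1) * b ^ l = i * b ^ h + (j + 1) * b ^ l := by rw [e]; ring
  have e3 : (j + 1) * b ^ l ≤ b ^ h := by rw [e]; exact Nat.mul_le_mul_right _ hj
  rw [← Finset.card_map (addLeftEmbedding (i * b ^ h))]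
  congr 1
  ext x
  simp only [slice, iv, Finset.mem_map, Finset.mem_inter, Finset.mem_filter, Finset.mem_range,
    Finset.mem_Ico, addLeftEmbedding_apply, e1, e2]
  constructor
  · rintro ⟨y, ⟨⟨_, h2⟩, h3, h4⟩, rfl⟩
    exact ⟨h2, by omega, by omega⟩
  · rintro ⟨h1, h2, h3⟩
    refine ⟨x - i * b ^ h, ⟨⟨by omega, ?_⟩, by omega, by omega⟩, by omega⟩
    rwa [show i * b ^ h + (x - i * b ^ h) = x by omega]

lemma card_eq_slices (a n : ℕ) (B : Finset ℕ) (hB : B ⊆ Finset.range (a * n)) :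
    B.card = ∑ i ∈ Finset.range a, (slice n B i).card := by
  have : B = (Finset.range (a * n)).filter (· ∈ B) := by
    ext x
    simp only [Finset.mem_filter]
    exact ⟨fun h => ⟨hB h, h⟩, fun h => h.2⟩
  conv_lhs => rw [this]
  rw [Finset.card_filter, sum_range_block]
  simp only [slice, Finset.card_filter]

lemma oddCount_succ (b h : ℕ) (hb : 2 ≤ b) (B : Finset ℕ) (hB : B ⊆ Finset.range (b ^ (h + 1))) :
    oddCount b (h + 1) B = (if Odd B.card then 1 else 0)
      + ∑ i ∈ Finset.range b, oddCount b h (slice (b ^ h) B i) := by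
  rw [oddCount_eq b _ hb, Finset.sum_range_succ, add_comm]
  congr 1
  · have : B ∩ iv b (h + 1, 0) = B := by
      rw [Finset.inter_eq_left]
      intro x hx
      simpa [iv] using hB hx
    rw [Nat.sub_self, pow_zero, Finset.sum_range_one, this]
  · simp_rw [oddCount_eq b h hb]
    rw [Finset.sum_comm]
    refine Finset.sum_congr rfl fun l hl => ?_
    have hl' : l ≤ h := by simp at hl; omega
    rw [show b ^ (h + 1 - l) = b * b ^ (h - l) by
      rw [← pow_succ']; congr 1; omega, sum_range_block]
    refine Finset.sum_congr rfl fun i _ => Finset.sum_congr rfl fun j hj => ?_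
    rw [card_slice_inter b h l i j hl' (by simpa using hj)]

lemma slice_glue (a n : ℕ) (f : ℕ → Finset ℕ) (hf : ∀ i < a, f i ⊆ Finset.range n)
    (i : ℕ) (hi : i < a) :
    slice n ((Finset.range (a * n)).filter fun x => x % n ∈ f (x / n)) i = f i := by
  ext x
  simp only [slice, Finset.mem_filter, Finset.mem_range]
  constructor
  · rintro ⟨h1, _, h3⟩
    rwa [mul_comm i n, Nat.mul_add_mod, Nat.mod_eq_of_lt h1, Nat.mul_add_div (by omega),
      Nat.div_eq_of_lt h1, add_zero] at h3
  · intro hx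
    have h1 : x < n := by simpa using hf i hi hx
    refine ⟨h1, ?_, ?_⟩
    · have := Nat.mul_le_mul_right n (show i + 1 ≤ a from hi)
      rw [Nat.succ_mul] at this
      omega
    · rwa [mul_comm i n, Nat.mul_add_mod, Nat.mod_eq_of_lt h1, Nat.mul_add_div (by omega),
        Nat.div_eq_of_lt h1, add_zero]

lemma slice_subset (n : ℕ) (B : Finset ℕ) (i : ℕ) : slice n B i ⊆ Finset.range n :=
  Finset.filter_subset _ _

lemma slice_card_le (n : ℕ) (B : Finset ℕ) (i : ℕ) : (slice n B i).card ≤ n := by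
  simpa using Finset.card_le_card (slice_subset n B i)

lemma le_Fb (b h : ℕ) (B : Finset ℕ) (hB : B ⊆ Finset.range (b ^ h)) :
    oddCount b h B ≤ Fb b h B.card :=
  Finset.le_sup (f := fun B => oddCount b h B) (Finset.mem_powersetCard.2 ⟨hB, rfl⟩)

lemma exists_Fb (b h k : ℕ) (hk : k ≤ b ^ h) :
    ∃ B ⊆ Finset.range (b ^ h), B.card = k ∧ Fb b h k = oddCount b h B := by
  obtain ⟨B, hB, e⟩ := Finset.exists_mem_eq_sup ((Finset.range (b ^ h)).powersetCard k)
    (Finset.powersetCard_nonempty.2 (by simpa using hk)) (fun B => oddCount b h B)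
  rw [Finset.mem_powersetCard] at hB
  exact ⟨B, hB.1, hB.2, e⟩

theorem stmt12 (b : ℕ) (hb : 2 ≤ b) :
    (∀ h : ℕ, 1 ≤ h → ∀ k : ℕ, k ≤ b ^ h →
        Fb b h k = (if Odd k then 1 else 0) +
          ((Fintype.piFinset fun _ : Fin b => Finset.range (b ^ (h - 1) + 1)).filter
              (fun κ => ∑ i, κ i = k)).sup
            (fun κ => ∑ i, Fb b (h - 1) (κ i))) ∧
      ∀ k : ℕ, k ≤ 1 → Fb b 0 k = k := by
  constructor
  · intro h hh k hk
    obtain ⟨h, rfl⟩ : ∃ m, h = m + 1 := ⟨h - 1, by omega⟩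
    simp only [Nat.add_sub_cancel]
    set S := (Fintype.piFinset fun _ : Fin b => Finset.range (b ^ h + 1)).filter
              (fun κ => ∑ i, κ i = k) with hS
    obtain ⟨B, hB, hBk, e⟩ := exists_Fb b (h + 1) k hk
    have hmem : (fun i : Fin b => (slice (b ^ h) B i).card) ∈ S := by
      simp only [hS, Finset.mem_filter, Fintype.mem_piFinset, Finset.mem_range]
      refine ⟨fun i => Nat.lt_succ_of_le (slice_card_le _ _ _), ?_⟩
      rw [← hBk, card_eq_slices b (b ^ h) B (by rwa [← pow_succ']), Finset.sum_range]
    apply le_antisymm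
    · rw [e, oddCount_succ b h hb B hB, hBk, Finset.sum_range]
      refine Nat.add_le_add_left ?_ _
      refine le_trans ?_ (Finset.le_sup (f := fun κ : Fin b → ℕ => ∑ i, Fb b h (κ i)) hmem)
      exact Finset.sum_le_sum fun i _ => le_Fb _ _ _ (slice_subset _ _ _)
    · obtain ⟨κ, hκ, e'⟩ := Finset.exists_mem_eq_sup S ⟨_, hmem⟩
        (fun κ : Fin b → ℕ => ∑ i, Fb b h (κ i))
      rw [e']
      simp only [hS, Finset.mem_filter, Fintype.mem_piFinset, Finset.mem_range] at hκ
      choose g hg1 hg2 hg3 using fun i => exists_Fb b h (κ i) (Nat.le_of_lt_succ (hκ.1 i))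
      let f : ℕ → Finset ℕ := fun i => if hi : i < b then g ⟨i, hi⟩ else ∅
      have hfg : ∀ i : Fin b, f i = g i := fun i => by simp [f]
      have hf : ∀ i < b, f i ⊆ Finset.range (b ^ h) := fun i hi => by
        rw [hfg ⟨i, hi⟩]; exact hg1 _
      let C := (Finset.range (b * b ^ h)).filter fun x => x % b ^ h ∈ f (x / b ^ h)
      have hC : C ⊆ Finset.range (b * b ^ h) := Finset.filter_subset _ _
      have hs : ∀ i : Fin b, slice (b ^ h) C i = g i := fun i => by
        rw [← hfg]; exact slice_glue b (b ^ h) f hf i i.2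
      have hCk : C.card = k := by
        rw [card_eq_slices b (b ^ h) C hC, Finset.sum_range, ← hκ.2]
        exact Finset.sum_congr rfl fun i _ => by rw [hs, hg2]
      have hC' : C ⊆ Finset.range (b ^ (h + 1)) := by rwa [pow_succ']
      have := le_Fb b (h + 1) C hC'
      rw [oddCount_succ b h hb C hC', hCk, Finset.sum_range] at this
      simp only [hs] at this
      simpa only [hg3] using this
  · intro k hk
    obtain ⟨B, hB, hBk, e⟩ := exists_Fb b 0 k (by simpa using hk)
    rw [e, oddCount_eq b 0 hb]
    have : B ∩ iv b (0, 0) = B := by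
      rw [Finset.inter_eq_left]
      intro x hx
      simpa [iv] using hB hx
    simp only [zero_add, Finset.sum_range_one, Nat.sub_zero, pow_zero, this, hBk]
    interval_cases k <;> simp
end

section
/- Let b ≥ 2, h ≥ 1 and 1 ≤ k ≤ b^h be integers, and let α_k = ⌈log_b k⌉. Then k·(h − α_k + 1) ≤ F_b(h, k) ≤ k·(h − α_k + 1) + (b^{α_k} − 1)/(b − 1). Moreover, the map k ↦ k·(h − α_k + 1) + (b^{α_k} − 1)/(b − 1) is monotonically non-decreasing in k on {1,…,b^h}. -/
/-- The upper bound `k·(h − α_k + 1) + (b^{α_k} − 1)/(b − 1)` where `α_k = ⌈log_b k⌉`. -/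
noncomputable def ub (b h k : ℕ) : ℝ :=
  (k : ℝ) * ((h : ℝ) - (Nat.clog b k : ℝ) + 1) +
    ((b : ℝ) ^ (Nat.clog b k) - 1) / ((b : ℝ) - 1)

theorem ub_eq_sum (b h k : ℕ) (hb : 2 ≤ b) (hk1 : 1 ≤ k) (hk : k ≤ b ^ h) :
    ub b h k = ((∑ d ∈ Finset.range (h + 1), min k (b ^ d) : ℕ) : ℝ) := by
  have hα : Nat.clog b k ≤ h := Nat.clog_le_of_le_pow hk
  have hα' : k ≤ b ^ Nat.clog b k := Nat.le_pow_clog (by omega) k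
  have hlt : ∀ d, d < Nat.clog b k → b ^ d ≤ k := by
    intro d hd
    exact (Nat.lt_clog_iff_pow_lt (by omega)).1 hd |>.le
  obtain ⟨m, hm⟩ := Nat.exists_eq_add_of_le hα
  unfold ub
  generalize Nat.clog b k = α at *
  subst hm
  rw [show α + m + 1 = α + (m + 1) by ring, Finset.sum_range_add]
  have h1 : ∑ d ∈ Finset.range α, min k (b ^ d) = ∑ d ∈ Finset.range α, b ^ d :=
    Finset.sum_congr rfl fun d hd => min_eq_right (hlt d (Finset.mem_range.1 hd))
  have h2 : ∑ d ∈ Finset.range (m + 1), min k (b ^ (α + d)) = ∑ d ∈ Finset.range (m + 1), k :=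
    Finset.sum_congr rfl fun d _ =>
      min_eq_left (hα'.trans (Nat.pow_le_pow_right (by omega) (by omega)))
  rw [h1, h2]
  have hb1 : (b : ℝ) ≠ 1 := by
    have : b ≠ 1 := by omega
    exact_mod_cast this
  push_cast
  rw [geom_sum_eq hb1]
  simp
  ring

theorem oddCount_le (b h k : ℕ) (B : Finset ℕ) (hB : B.card = k) :
    oddCount b h B ≤ ∑ d ∈ Finset.range (h + 1), min k (b ^ d) := by
  rw [← Finset.sum_range_reflect]
  unfold oddCount
  rw [Finset.card_eq_sum_card_fiberwise (f := Prod.fst) (t := Finset.range (h + 1))]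
  · apply Finset.sum_le_sum
    intro l hl
    have hl' : l < h + 1 := Finset.mem_range.1 hl
    rw [show h + 1 - 1 - l = h - l by omega]
    apply le_min
    · rw [← hB]
      refine le_trans (Finset.card_le_card ?_)
        (Finset.card_image_le (s := B) (f := fun x => (l, x / b ^ l)))
      intro q hq
      simp only [Finset.mem_filter] at hq
      obtain ⟨⟨hq1, hodd⟩, rfl⟩ := hq
      obtain ⟨x, hx⟩ := Finset.card_pos.1 hodd.pos
      simp only [iv, Finset.mem_inter, Finset.mem_Ico] at hx
      refine Finset.mem_image.2 ⟨x, hx.1, ?_⟩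
      ext
      · rfl
      · exact Nat.div_eq_of_lt_le hx.2.1 hx.2.2
    · rw [← Finset.card_range (b ^ (h - l))]
      apply Finset.card_le_card_of_injOn Prod.snd
      · intro q hq
        simp [treeNodes] at hq ⊢
        obtain ⟨⟨⟨_, h2⟩, _⟩, rfl⟩ := hq
        exact h2
      · intro p hp q hq hpq
        simp at hp hq
        exact Prod.ext (hp.2.trans hq.2.symm) hpq
  · intro q hq
    simp [treeNodes] at hq ⊢
    exact hq.1.1.1

theorem le_Fb_s13 (b h k α : ℕ) (hb : 2 ≤ b) (hα : α ≤ h) (hk : k ≤ b ^ α) :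
    k * (h - α + 1) ≤ Fb b h k := by
  obtain ⟨m, rfl⟩ := Nat.exists_eq_add_of_le hα
  have hbp : ∀ n, 0 < b ^ n := fun n => Nat.pow_pos (by omega)
  have hinj : Function.Injective fun i : ℕ => i * b ^ m :=
    fun i j hij => Nat.eq_of_mul_eq_mul_right (hbp m) hij
  set B : Finset ℕ := (Finset.range k).image fun i => i * b ^ m with hBdef
  have hB : B ∈ (Finset.range (b ^ (α + m))).powersetCard k := by
    rw [Finset.mem_powersetCard]
    constructor
    · intro x hx
      obtain ⟨i, hi, rfl⟩ := Finset.mem_image.1 hx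
      rw [Finset.mem_range] at hi ⊢
      rw [pow_add]
      exact Nat.mul_lt_mul_of_pos_right (by omega) (hbp m)
    · rw [hBdef, Finset.card_image_of_injective _ hinj, Finset.card_range]
  refine le_trans ?_ (Finset.le_sup (f := fun B => oddCount b (α + m) B) hB)
  have hc : k * (α + m - α + 1) = (Finset.range (m + 1) ×ˢ Finset.range k).card := by
    rw [Finset.card_product, Finset.card_range, Finset.card_range, mul_comm]
    congr 2; omega
  rw [hc]
  show _ ≤ oddCount b (α + m) B
  unfold oddCount
  apply Finset.card_le_card_of_injOn fun p => (p.1, p.2 * b ^ (m - p.1))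
  · rintro ⟨l, i⟩ hp
    simp only [Finset.coe_product, Set.mem_prod, Finset.mem_coe, Finset.mem_range] at hp
    obtain ⟨hl, hi⟩ := hp
    have hlt : i * b ^ (m - l) < b ^ (α + m - l) := by
      rw [show α + m - l = α + (m - l) by omega, pow_add]
      exact Nat.mul_lt_mul_of_pos_right (by omega) (hbp _)
    have hle : b ^ (α + m - l) ≤ b ^ (α + m) := Nat.pow_le_pow_right (by omega) (by omega)
    have hsing : B ∩ iv b (l, i * b ^ (m - l)) = {i * b ^ m} := by
      have e : i * b ^ (m - l) * b ^ l = i * b ^ m := by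
        rw [mul_assoc, ← pow_add]; congr 2; omega
      have hlm : b ^ l ≤ b ^ m := Nat.pow_le_pow_right (by omega) (by omega)
      ext x
      simp only [iv, Finset.mem_inter, Finset.mem_Ico, Finset.mem_singleton, add_mul, one_mul, e]
      constructor
      · rintro ⟨hx, h1, h2⟩
        obtain ⟨j, hj, rfl⟩ := Finset.mem_image.1 hx
        have h3 : i ≤ j := Nat.le_of_mul_le_mul_right h1 (hbp m)
        have h4 : j < i + 1 := by
          apply Nat.lt_of_mul_lt_mul_right (a := b ^ m)
          rw [add_mul, one_mul]
          exact h2.trans_le (by omega)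
        rw [show j = i by omega]
      · rintro rfl
        have := hbp l
        exact ⟨Finset.mem_image.2 ⟨i, Finset.mem_range.2 hi, rfl⟩, le_rfl, by omega⟩
    simp only [Finset.coe_filter, Set.mem_setOf_eq]
    rw [hsing]
    refine ⟨?_, by simp⟩
    simp only [treeNodes, Finset.mem_filter, Finset.mem_product, Finset.mem_range]
    exact ⟨⟨by omega, by omega⟩, hlt⟩
  · rintro ⟨l, i⟩ _ ⟨l', i'⟩ _ heq
    simp only [Prod.mk.injEq] at heq
    obtain ⟨rfl, h2⟩ := heq
    rw [Nat.eq_of_mul_eq_mul_right (hbp _) h2]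

theorem stmt13 (b h k : ℕ) (hb : 2 ≤ b) (hh : 1 ≤ h) (hk1 : 1 ≤ k) (hk : k ≤ b ^ h) :
    ((k : ℝ) * ((h : ℝ) - (Nat.clog b k : ℝ) + 1) ≤ (Fb b h k : ℝ) ∧
        (Fb b h k : ℝ) ≤ ub b h k) ∧
      ∀ k₁ k₂ : ℕ, 1 ≤ k₁ → k₁ ≤ k₂ → k₂ ≤ b ^ h → ub b h k₁ ≤ ub b h k₂ := by
  refine ⟨⟨?_, ?_⟩, ?_⟩
  · have hα : Nat.clog b k ≤ h := Nat.clog_le_of_le_pow hk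
    have h1 := le_Fb_s13 b h k (Nat.clog b k) hb hα (Nat.le_pow_clog (by omega) k)
    have h2 : ((k * (h - Nat.clog b k + 1) : ℕ) : ℝ) ≤ (Fb b h k : ℝ) := by exact_mod_cast h1
    push_cast [Nat.cast_sub hα] at h2
    exact h2
  · rw [ub_eq_sum b h k hb hk1 hk]
    have : Fb b h k ≤ ∑ d ∈ Finset.range (h + 1), min k (b ^ d) :=
      Finset.sup_le fun B hB => oddCount_le b h k B (Finset.mem_powersetCard.1 hB).2
    exact_mod_cast this
  · intro k₁ k₂ h1 h12 h2
    rw [ub_eq_sum b h k₁ hb h1 (h12.trans h2), ub_eq_sum b h k₂ hb (h1.trans h12) h2]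
    have : ∑ d ∈ Finset.range (h + 1), min k₁ (b ^ d) ≤
        ∑ d ∈ Finset.range (h + 1), min k₂ (b ^ d) :=
      Finset.sum_le_sum fun d _ => min_le_min_right _ h12
    exact_mod_cast this
end

section
/- Let b ≥ 2, h ≥ 1 and 1 ≤ k ≤ b^h be integers, T = b^h, let p ≥ 1 be real, and let α_k = ⌈log_b k⌉. Then max( k·(h − α_k + 1), b^{α_k − 1}·(h − α_k + 2) ) ≤ sens_p(R_b, S_{1,k})^p ≤ k·(h − α_k + 1) + (b^{α_k} − 1)/(b − 1). -/
/-- Integer value of a node. -/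
def nval (b h : ℕ) (Δ : Fin (b ^ h) → ℤ) (q : Fin (h + 1) × Fin (b ^ h)) : ℤ :=
  ∑ t ∈ Finset.univ.filter (fun t : Fin (b ^ h) => (t : ℕ) / b ^ (q.1 : ℕ) = (q.2 : ℕ)), Δ t

lemma mulVec_eq (b h : ℕ) (hb : 2 ≤ b) (Δ : Fin (b ^ h) → ℤ) (q : Fin (h + 1) × Fin (b ^ h)) :
    (nodeMatrix b h).mulVec (fun t => (Δ t : ℝ)) q = (nval b h Δ q : ℝ) := by
  have hB : 0 < b ^ (q.1 : ℕ) := by positivity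
  unfold nval
  rw [Finset.sum_filter]
  push_cast
  unfold Matrix.mulVec dotProduct
  refine Finset.sum_congr rfl fun t _ => ?_
  have : ((q.2 : ℕ) * b ^ (q.1 : ℕ) ≤ (t : ℕ) ∧ (t : ℕ) < ((q.2 : ℕ) + 1) * b ^ (q.1 : ℕ)) ↔
      (t : ℕ) / b ^ (q.1 : ℕ) = (q.2 : ℕ) := by
    rw [← Nat.le_div_iff_mul_le hB, ← Nat.div_lt_iff_lt_mul hB]
    omega
  unfold nodeMatrix
  simp only [this]
  split_ifs <;> simp

lemma nval_abs_le (b h : ℕ) (Δ : Fin (b ^ h) → ℤ) (hΔ : memS (b ^ h) 1 Δ)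
    (q : Fin (h + 1) × Fin (b ^ h)) : |nval b h Δ q| ≤ 1 := by
  unfold nval
  set s := Finset.univ.filter (fun t : Fin (b ^ h) => (t : ℕ) / b ^ (q.1 : ℕ) = (q.2 : ℕ)) with hs
  rcases s.eq_empty_or_nonempty with h0 | h0
  · rw [h0]; simp
  · have : s = Finset.Icc (s.min' h0) (s.max' h0) := by
      ext t
      rw [Finset.mem_Icc]
      constructor
      · intro ht
        exact ⟨s.min'_le t ht, s.le_max' t ht⟩
      · rintro ⟨h1, h2⟩
        have e1 := s.min'_mem h0
        have e2 := s.max'_mem h0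
        have mi : ∀ t, t ∈ s ↔ t ∈ Finset.univ ∧ (t : ℕ) / b ^ (q.1 : ℕ) = (q.2 : ℕ) :=
          fun t => Finset.mem_filter
        rw [mi] at e1 e2 ⊢
        refine ⟨Finset.mem_univ _, le_antisymm ?_ ?_⟩
        · rw [← e2.2]; exact Nat.div_le_div_right h2
        · rw [← e1.2]; exact Nat.div_le_div_right h1
    rw [this]
    exact_mod_cast hΔ _ _ (s.min'_le _ (s.max'_mem h0))

lemma level_le_k (b h k : ℕ) (Δ : Fin (b ^ h) → ℤ) (hΔ : (∑ t, |Δ t|) ≤ (k : ℤ))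
    (l : Fin (h + 1)) : ∑ j, |nval b h Δ (l, j)| ≤ (k : ℤ) := by
  refine le_trans ?_ hΔ
  calc ∑ j, |nval b h Δ (l, j)|
      ≤ ∑ j : Fin (b ^ h), ∑ t : Fin (b ^ h),
          (if (t : ℕ) / b ^ (l : ℕ) = (j : ℕ) then |Δ t| else 0) := by
        refine Finset.sum_le_sum fun j _ => ?_
        rw [← Finset.sum_filter]
        exact Finset.abs_sum_le_sum_abs _ _
    _ = ∑ t : Fin (b ^ h), ∑ j : Fin (b ^ h),
          (if (t : ℕ) / b ^ (l : ℕ) = (j : ℕ) then |Δ t| else 0) := Finset.sum_comm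
    _ ≤ ∑ t, |Δ t| := by
        refine Finset.sum_le_sum fun t _ => ?_
        have ht : (t : ℕ) / b ^ (l : ℕ) < b ^ h := lt_of_le_of_lt (Nat.div_le_self _ _) t.2
        rw [Finset.sum_eq_single (⟨_, ht⟩ : Fin (b ^ h))]
        · simp
        · intro j _ hj
          rw [if_neg]
          intro e
          exact hj (Fin.ext e.symm)
        · simp

lemma level_le_pow (b h : ℕ) (hb : 2 ≤ b) (Δ : Fin (b ^ h) → ℤ) (hΔ : memS (b ^ h) 1 Δ)
    (l : Fin (h + 1)) : ∑ j, |nval b h Δ (l, j)| ≤ ((b ^ (h - (l : ℕ)) : ℕ) : ℤ) := by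
  have hB : 0 < b ^ (l : ℕ) := by positivity
  calc ∑ j, |nval b h Δ (l, j)|
      ≤ ∑ j : Fin (b ^ h), (if (j : ℕ) < b ^ (h - (l : ℕ)) then 1 else 0) := by
        refine Finset.sum_le_sum fun j _ => ?_
        split_ifs with hj
        · exact nval_abs_le b h Δ hΔ _
        · have : nval b h Δ (l, j) = 0 := by
            unfold nval
            rw [Finset.filter_eq_empty_iff.2, Finset.sum_empty]
            intro t _ e
            apply hj
            simp only at e
            rw [← e, Nat.div_lt_iff_lt_mul hB, ← pow_add,
              Nat.sub_add_cancel (Nat.lt_succ_iff.1 l.2)]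
            exact t.2
          simp [this]
    _ ≤ _ := by
        rw [Fin.sum_univ_eq_sum_range (fun j => if j < b ^ (h - (l : ℕ)) then (1 : ℤ) else 0),
          ← Finset.sum_filter, Finset.sum_const, nsmul_eq_mul, mul_one]
        have : (Finset.range (b ^ h)).filter (fun j => j < b ^ (h - (l : ℕ))) ⊆
            Finset.range (b ^ (h - (l : ℕ))) := by
          intro x hx
          simp at hx ⊢
          exact hx.2
        have := Finset.card_le_card this
        rw [Finset.card_range] at this
        exact_mod_cast this

lemma total_le (b h k : ℕ) (hb : 2 ≤ b) (ha : Nat.clog b k ≤ h)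
    (Δ : Fin (b ^ h) → ℤ) (hΔ : Δ ∈ SDk (b ^ h) 1 k) :
    (((∑ q, |nval b h Δ q| : ℤ)) : ℝ) ≤ (k : ℝ) * ((h : ℝ) - (Nat.clog b k : ℝ) + 1) +
        ((b : ℝ) ^ (Nat.clog b k) - 1) / ((b : ℝ) - 1) := by
  set a := Nat.clog b k
  have h1 : ∑ q, |nval b h Δ q| ≤ ((∑ i ∈ Finset.range (h + 1), min k (b ^ i) : ℕ) : ℤ) := by
    rw [← Finset.sum_range_reflect, ← Fin.sum_univ_eq_sum_range
      (fun j => min k (b ^ (h + 1 - 1 - j))), Fintype.sum_prod_type, Nat.cast_sum]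
    refine Finset.sum_le_sum fun l _ => ?_
    rw [Nat.cast_min]
    exact le_min (level_le_k b h k Δ hΔ.2 l) (level_le_pow b h hb Δ hΔ.1 l)
  have h2 : ∑ i ∈ Finset.range (h + 1), min k (b ^ i) ≤
      ∑ i ∈ Finset.range a, b ^ i + (h + 1 - a) * k := by
    rw [← Finset.sum_range_add_sum_Ico _ (show a ≤ h + 1 by omega)]
    refine add_le_add (Finset.sum_le_sum fun i _ => min_le_right _ _) ?_
    refine (Finset.sum_le_sum fun i _ => min_le_left _ _).trans ?_
    simp
  have h3 : (((∑ q, |nval b h Δ q| : ℤ)) : ℝ) ≤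
      ((∑ i ∈ Finset.range a, b ^ i + (h + 1 - a) * k : ℕ) : ℝ) := by
    have := h1.trans (Nat.cast_le.2 h2)
    exact_mod_cast this
  refine h3.trans (le_of_eq ?_)
  have hb1 : (b : ℝ) ≠ 1 := by
    have : (2 : ℝ) ≤ b := by exact_mod_cast hb
    linarith
  push_cast [Nat.cast_sub (show a ≤ h + 1 by omega)]
  rw [geom_sum_eq hb1]
  ring

lemma pow_abs_eq (p : ℝ) (hp : 1 ≤ p) (v : ℤ) (hv : |v| ≤ 1) : |(v : ℝ)| ^ p = ((|v| : ℤ) : ℝ) := by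
  have : v = -1 ∨ v = 0 ∨ v = 1 := by
    rw [abs_le] at hv; omega
  rcases this with rfl | rfl | rfl
  · simp
  · simp [Real.zero_rpow (by linarith : p ≠ 0)]
  · simp

lemma pnorm_eq (b h : ℕ) (hb : 2 ≤ b) (p : ℝ) (hp : 1 ≤ p) (Δ : Fin (b ^ h) → ℤ)
    (hΔ : memS (b ^ h) 1 Δ) :
    pnorm p ((nodeMatrix b h).mulVec (fun t => (Δ t : ℝ))) =
      (((∑ q, |nval b h Δ q| : ℤ)) : ℝ) ^ (1 / p) := by
  unfold pnorm
  congr 1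
  push_cast
  refine Finset.sum_congr rfl fun q _ => ?_
  rw [mulVec_eq b h hb, pow_abs_eq p hp _ (nval_abs_le b h Δ hΔ q)]
  push_cast; rfl

/-- Cumulative counter. -/
def cnt (m w n : ℕ) : ℕ := min m ((n + w - 1) / w)

/-- Prefix sums of the alternating vector. -/
def pre (m w n : ℕ) : ℤ := ((cnt m w n % 2 : ℕ) : ℤ)

/-- The alternating vector. -/
def alt (m w N : ℕ) (t : Fin N) : ℤ := pre m w ((t : ℕ) + 1) - pre m w t

lemma cnt_mono (m w : ℕ) {x y : ℕ} (h : x ≤ y) : cnt m w x ≤ cnt m w y := by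
  unfold cnt
  exact min_le_min le_rfl (Nat.div_le_div_right (by omega))

lemma cnt_succ (m w n : ℕ) (hw : 0 < w) : cnt m w (n + 1) ≤ cnt m w n + 1 := by
  unfold cnt
  have : (n + 1 + w - 1) / w ≤ (n + w - 1) / w + 1 := by
    rw [← Nat.add_div_right _ hw]
    exact Nat.div_le_div_right (by omega)
  omega

lemma tele (g : ℕ → ℤ) {x y : ℕ} (h : x ≤ y) :
    ∑ t ∈ Finset.Ico x y, (g (t + 1) - g t) = g y - g x := by
  induction y, h using Nat.le_induction with
  | base => simp
  | succ n hn ih => rw [Finset.sum_Ico_succ_top hn, ih]; ring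

lemma alt_mem (m w N k : ℕ) (hw : 0 < w) (hm : m ≤ k) : alt m w N ∈ SDk N 1 k := by
  constructor
  · intro i j hij
    have : ∑ t ∈ Finset.Icc i j, alt m w N t = pre m w ((j : ℕ) + 1) - pre m w i := by
      rw [← tele (pre m w) (show (i : ℕ) ≤ (j : ℕ) + 1 from Nat.le_succ_of_le hij)]
      have e : Finset.Ico (i : ℕ) ((j : ℕ) + 1) = (Finset.Icc i j).map Fin.valEmbedding := by
        rw [Fin.map_valEmbedding_Icc]
        ext x; simp
      rw [e, Finset.sum_map]
      rfl
    rw [this, abs_le]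
    unfold pre
    push_cast
    omega
  · have h1 : ∀ t : Fin N, |alt m w N t| ≤ ((cnt m w ((t : ℕ) + 1) : ℕ) : ℤ) - (cnt m w t : ℕ) := by
      intro t
      have a1 := cnt_succ m w t hw
      have a2 := cnt_mono m w (show (t : ℕ) ≤ t + 1 by omega)
      unfold alt pre
      rw [abs_le]
      omega
    refine (Finset.sum_le_sum fun t _ => h1 t).trans ?_
    rw [Fin.sum_univ_eq_sum_range (fun t => ((cnt m w (t + 1) : ℕ) : ℤ) - (cnt m w t : ℕ)),
      Finset.sum_range_sub (fun t => ((cnt m w t : ℕ) : ℤ))]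
    have : cnt m w N ≤ m := min_le_left _ _
    omega

lemma alt_nval (b h a m l i j : ℕ) (hb : 2 ≤ b) (ha : a ≤ h) (hm : m ≤ b ^ a) (hi : i < m)
    (hl : l ≤ h - a) (hl' : l < h + 1) (hj : j < b ^ h) (hji : j = i * b ^ (h - a - l)) :
    |nval b h (alt m (b ^ (h - a)) (b ^ h)) (⟨l, hl'⟩, ⟨j, hj⟩)| = 1 := by
  have hB : 0 < b ^ l := by positivity
  have hw : 0 < b ^ (h - a) := by positivity
  have hBw : b ^ l ≤ b ^ (h - a) := Nat.pow_le_pow_right (by omega) hl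
  have hjB : j * b ^ l = i * b ^ (h - a) := by
    rw [hji, mul_assoc, ← pow_add, Nat.sub_add_cancel hl]
  have hend : j * b ^ l + b ^ l ≤ b ^ h := by
    calc j * b ^ l + b ^ l ≤ i * b ^ (h - a) + b ^ (h - a) := by omega
      _ = (i + 1) * b ^ (h - a) := by ring
      _ ≤ b ^ a * b ^ (h - a) := Nat.mul_le_mul_right _ (by omega)
      _ = b ^ h := by rw [← pow_add]; congr 1; omega
  have hv : nval b h (alt m (b ^ (h - a)) (b ^ h)) (⟨l, hl'⟩, ⟨j, hj⟩) =
      pre m (b ^ (h - a)) (j * b ^ l + b ^ l) - pre m (b ^ (h - a)) (j * b ^ l) := by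
    rw [← tele (pre m (b ^ (h - a))) (Nat.le_add_right _ _)]
    unfold nval
    have e : Finset.Ico (j * b ^ l) (j * b ^ l + b ^ l) =
        (Finset.univ.filter (fun t : Fin (b ^ h) => (t : ℕ) / b ^ l = j)).map
          Fin.valEmbedding := by
      ext x
      simp only [Finset.mem_Ico, Finset.mem_map, Finset.mem_filter, Finset.mem_univ, true_and,
        Fin.valEmbedding_apply]
      have key : (j * b ^ l ≤ x ∧ x < j * b ^ l + b ^ l) ↔ x / b ^ l = j := by
        rw [← Nat.succ_mul, ← Nat.le_div_iff_mul_le hB, ← Nat.div_lt_iff_lt_mul hB]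
        omega
      constructor
      · intro hx
        exact ⟨⟨x, by omega⟩, key.1 hx, rfl⟩
      · rintro ⟨y, hy, rfl⟩
        exact key.2 hy
    rw [e, Finset.sum_map]
    rfl
  have c1 : cnt m (b ^ (h - a)) (j * b ^ l) = i := by
    unfold cnt
    have : (j * b ^ l + b ^ (h - a) - 1) / b ^ (h - a) = i := by
      rw [hjB]
      apply Nat.div_eq_of_lt_le
      · omega
      · rw [Nat.succ_mul]; omega
    omega
  have c2 : cnt m (b ^ (h - a)) (j * b ^ l + b ^ l) = i + 1 := by
    unfold cnt
    have : (j * b ^ l + b ^ l + b ^ (h - a) - 1) / b ^ (h - a) = i + 1 := by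
      rw [hjB]
      apply Nat.div_eq_of_lt_le
      · rw [Nat.succ_mul]; omega
      · rw [Nat.succ_mul, Nat.succ_mul]; omega
    omega
  rw [hv]
  unfold pre
  rw [c1, c2]
  rcases Nat.mod_two_eq_zero_or_one i with hi2 | hi2
  · have : (i + 1) % 2 = 1 := by omega
    rw [hi2, this]; simp
  · have : (i + 1) % 2 = 0 := by omega
    rw [hi2, this]; simp

lemma alt_total (b h a m : ℕ) (hb : 2 ≤ b) (ha : a ≤ h) (hm : m ≤ b ^ a) :
    ((m * (h - a + 1) : ℕ) : ℤ) ≤ ∑ q, |nval b h (alt m (b ^ (h - a)) (b ^ h)) q| := by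
  have hjlt : ∀ (l : Fin (h - a + 1)) (i : Fin m), (i : ℕ) * b ^ (h - a - l) < b ^ h := by
    intro l i
    calc (i : ℕ) * b ^ (h - a - l) < b ^ a * b ^ (h - a - l) :=
          Nat.mul_lt_mul_of_pos_right (by omega) (by positivity)
      _ = b ^ (a + (h - a - l)) := by rw [← pow_add]
      _ ≤ b ^ h := Nat.pow_le_pow_right (by omega) (by omega)
  let f : Fin (h - a + 1) × Fin m → Fin (h + 1) × Fin (b ^ h) :=
    fun x => (⟨x.1, by omega⟩, ⟨(x.2 : ℕ) * b ^ (h - a - x.1), hjlt x.1 x.2⟩)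
  have hf : Function.Injective f := by
    rintro ⟨l, i⟩ ⟨l', i'⟩ e
    simp only [f, Prod.mk.injEq, Fin.mk.injEq] at e
    obtain ⟨e1, e2⟩ := e
    have e1 := Fin.ext e1
    subst e1
    have := Nat.eq_of_mul_eq_mul_right (by positivity) e2
    rw [Fin.ext this]
  calc ((m * (h - a + 1) : ℕ) : ℤ)
      = ∑ x : Fin (h - a + 1) × Fin m, |nval b h (alt m (b ^ (h - a)) (b ^ h)) (f x)| := by
        rw [Finset.sum_congr rfl (g := fun _ => (1 : ℤ))]
        · simp; ring
        · intro x _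
          exact alt_nval b h a m x.1 x.2 _ hb ha hm x.2.2 (by omega) _ _ rfl
    _ = ∑ q ∈ Finset.univ.map ⟨f, hf⟩, |nval b h (alt m (b ^ (h - a)) (b ^ h)) q| := by
        rw [Finset.sum_map]; rfl
    _ ≤ _ := Finset.sum_le_sum_of_subset_of_nonneg (Finset.subset_univ _)
        (fun _ _ _ => abs_nonneg _)

lemma sens_lower (b h k a m : ℕ) (hb : 2 ≤ b) (hk : Nat.clog b k ≤ h) (ha : a ≤ h)
    (hm : m ≤ b ^ a) (hmk : m ≤ k) (p : ℝ) (hp : 1 ≤ p) :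
    (m : ℝ) * ((h : ℝ) - a + 1) ≤ sens p (nodeMatrix b h) (SDk (b ^ h) 1 k) ^ p := by
  have hp0 : 0 < p := by linarith
  have hbd : BddAbove ((fun Δ => pnorm p ((nodeMatrix b h).mulVec fun t => (Δ t : ℝ))) ''
      (SDk (b ^ h) 1 k)) := by
    refine ⟨((k : ℝ) * ((h : ℝ) - (Nat.clog b k : ℝ) + 1) +
        ((b : ℝ) ^ (Nat.clog b k) - 1) / ((b : ℝ) - 1)) ^ (1 / p), ?_⟩
    rintro _ ⟨Δ, hΔ, rfl⟩
    simp only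
    rw [pnorm_eq b h hb p hp Δ hΔ.1]
    refine Real.rpow_le_rpow ?_ (total_le b h k hb hk Δ hΔ) (by positivity)
    exact_mod_cast Finset.sum_nonneg fun _ _ => abs_nonneg _
  have hmem := alt_mem m (b ^ (h - a)) (b ^ h) k (by positivity) hmk
  have h1 : pnorm p ((nodeMatrix b h).mulVec
      fun t => (alt m (b ^ (h - a)) (b ^ h) t : ℝ)) ≤ sens p (nodeMatrix b h) (SDk (b ^ h) 1 k) :=
    le_csSup hbd ⟨_, hmem, rfl⟩
  rw [pnorm_eq b h hb p hp _ hmem.1] at h1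
  have hT := alt_total b h a m hb ha hm
  set X := ∑ q, |nval b h (alt m (b ^ (h - a)) (b ^ h)) q| with hX
  have hX0 : (0 : ℝ) ≤ (X : ℝ) := by
    exact_mod_cast Finset.sum_nonneg fun _ _ => abs_nonneg _
  have h2 := Real.rpow_le_rpow (by positivity) h1 hp0.le
  rw [← Real.rpow_mul hX0, one_div_mul_cancel hp0.ne', Real.rpow_one] at h2
  refine le_trans ?_ h2
  have h3 : (((m * (h - a + 1) : ℕ) : ℤ) : ℝ) ≤ (X : ℝ) := by exact_mod_cast hT
  refine le_trans (le_of_eq ?_) h3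
  push_cast [Nat.cast_sub ha]
  ring

theorem stmt14 (b h k : ℕ) (hb : 2 ≤ b) (hh : 1 ≤ h) (hk1 : 1 ≤ k) (hk : k ≤ b ^ h)
    (p : ℝ) (hp : 1 ≤ p) :
    max ((k : ℝ) * ((h : ℝ) - (Nat.clog b k : ℝ) + 1))
        ((b : ℝ) ^ (Nat.clog b k) / (b : ℝ) * ((h : ℝ) - (Nat.clog b k : ℝ) + 2)) ≤
      sens p (nodeMatrix b h) (SDk (b ^ h) 1 k) ^ p ∧
    sens p (nodeMatrix b h) (SDk (b ^ h) 1 k) ^ p ≤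
      (k : ℝ) * ((h : ℝ) - (Nat.clog b k : ℝ) + 1) +
        ((b : ℝ) ^ (Nat.clog b k) - 1) / ((b : ℝ) - 1) := by
  have hcl : Nat.clog b k ≤ h := Nat.clog_le_of_le_pow hk
  have hkp : k ≤ b ^ Nat.clog b k := Nat.le_pow_clog (by omega) k
  have hp0 : 0 < p := by linarith
  have hb' : (2 : ℝ) ≤ b := by exact_mod_cast hb
  have L1 := sens_lower b h k (Nat.clog b k) k hb hcl hcl hkp le_rfl p hp
  refine ⟨max_le L1 ?_, ?_⟩
  · rcases Nat.eq_zero_or_pos (Nat.clog b k) with h0 | h0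
    · refine le_trans ?_ L1
      rw [h0]
      have hk1' : (1 : ℝ) ≤ k := by exact_mod_cast hk1
      have hh0 : (0 : ℝ) ≤ h := Nat.cast_nonneg h
      simp only [pow_zero, Nat.cast_zero, sub_zero]
      rw [div_mul_eq_mul_div, div_le_iff₀ (by linarith)]
      have : (h : ℝ) + 1 ≤ k * (h + 1) := by nlinarith
      nlinarith
    · obtain ⟨c, hc⟩ : ∃ c, Nat.clog b k = c + 1 := ⟨Nat.clog b k - 1, by omega⟩
      have hck : b ^ c ≤ k := by
        by_contra hcon
        have := Nat.clog_le_of_le_pow (le_of_lt (not_le.1 hcon))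
        omega
      have L2 := sens_lower b h k c (b ^ c) hb hcl (by omega) le_rfl hck p hp
      refine le_trans (le_of_eq ?_) L2
      rw [hc]
      have : (b : ℝ) ≠ 0 := by linarith
      push_cast
      rw [pow_succ, mul_div_assoc, div_self this]
      ring
  · set U := (k : ℝ) * ((h : ℝ) - (Nat.clog b k : ℝ) + 1) +
        ((b : ℝ) ^ (Nat.clog b k) - 1) / ((b : ℝ) - 1) with hU
    have hU0 : 0 ≤ U := by
      refine le_trans ?_ (total_le b h k hb hcl _
        (alt_mem 0 1 (b ^ h) k Nat.one_pos (Nat.zero_le k)))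
      exact_mod_cast Finset.sum_nonneg fun _ _ => abs_nonneg _
    have hle : sens p (nodeMatrix b h) (SDk (b ^ h) 1 k) ≤ U ^ (1 / p) := by
      apply Real.sSup_le
      · rintro _ ⟨Δ, hΔ, rfl⟩
        simp only
        rw [pnorm_eq b h hb p hp Δ hΔ.1]
        refine Real.rpow_le_rpow ?_ (total_le b h k hb hcl Δ hΔ) (by positivity)
        exact_mod_cast Finset.sum_nonneg fun _ _ => abs_nonneg _
      · positivity
    have h0 : 0 ≤ sens p (nodeMatrix b h) (SDk (b ^ h) 1 k) := by
      apply Real.sSup_nonneg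
      rintro _ ⟨Δ, hΔ, rfl⟩
      simp only [pnorm]
      positivity
    have := Real.rpow_le_rpow h0 hle hp0.le
    rwa [← Real.rpow_mul hU0, one_div_mul_cancel hp0.ne', Real.rpow_one] at this
end

section
/- Let b ≥ 3, h ≥ 1 and 1 ≤ k ≤ b^h be integers, T = b^h, let p ≥ 1 be real, and let α_k = ⌈log_b k⌉. Then max( k·(h − α_k + 1 − 1/b), b^{α_k − 1}·(h − α_k + 2 − 1/b) ) ≤ sens_p(R̂_b, S_{1,k})^p ≤ k·(h − α_k + 1) + b^{α_k − 1}. -/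
/-- The reduced matrix `R̂_b` of the complete `b`-ary tree of height `h`:
as `R_b`, but rows of non-counted nodes (left-most children, other than the root)
are replaced by zero rows. Rows are indexed by node coordinates `(ℓ, j)`; rows
whose coordinates do not correspond to a tree node are identically zero. -/
def nodeMatrixHat (b h : ℕ) : Matrix (Fin (h + 1) × Fin (b ^ h)) (Fin (b ^ h)) ℝ :=
  fun q t =>
    if ((q.1 : ℕ) = h ∨ (q.2 : ℕ) % b ≠ 0) ∧
        (q.2 : ℕ) * b ^ (q.1 : ℕ) ≤ (t : ℕ) ∧ (t : ℕ) < ((q.2 : ℕ) + 1) * b ^ (q.1 : ℕ) then 1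
    else 0

namespace Stmt16Aux

/-- Integer node sum. -/
def Z (b h : ℕ) (Δ : Fin (b ^ h) → ℤ) (l j : ℕ) : ℤ :=
  ∑ t : Fin (b ^ h), if (l = h ∨ j % b ≠ 0) ∧ (t : ℕ) / b ^ l = j then Δ t else 0

lemma cond_iff (b l j t : ℕ) (hb : 3 ≤ b) :
    (j * b ^ l ≤ t ∧ t < (j + 1) * b ^ l) ↔ t / b ^ l = j := by
  have hpos : 0 < b ^ l := by positivity
  constructor
  · rintro ⟨h1, h2⟩
    apply le_antisymm
    · exact Nat.le_of_lt_succ ((Nat.div_lt_iff_lt_mul hpos).2 h2)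
    · exact (Nat.le_div_iff_mul_le hpos).2 h1
  · rintro rfl
    exact ⟨Nat.div_mul_le_self _ _, (Nat.div_lt_iff_lt_mul hpos).1 (Nat.lt_succ_self _)⟩

lemma mulVec_eq (b h : ℕ) (hb : 3 ≤ b) (Δ : Fin (b ^ h) → ℤ) (q : Fin (h + 1) × Fin (b ^ h)) :
    (nodeMatrixHat b h).mulVec (fun t => (Δ t : ℝ)) q = (Z b h Δ q.1 q.2 : ℝ) := by
  unfold Matrix.mulVec dotProduct nodeMatrixHat Z
  push_cast
  refine Finset.sum_congr rfl fun t _ => ?_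
  simp only [cond_iff _ _ _ _ hb]
  split_ifs <;> simp

lemma conv_sum {T : ℕ} (Δ : Fin T → ℤ) (hΔ : memS T 1 Δ) (a c : ℕ) :
    |∑ t : Fin T, if a ≤ (t : ℕ) ∧ (t : ℕ) < c then Δ t else 0| ≤ 1 := by
  rw [← Finset.sum_filter]
  by_cases hne : (Finset.univ.filter fun t : Fin T => a ≤ (t : ℕ) ∧ (t : ℕ) < c).Nonempty
  · set s := (Finset.univ.filter fun t : Fin T => a ≤ (t : ℕ) ∧ (t : ℕ) < c) with hs
    have : s = Finset.Icc (s.min' hne) (s.max' hne) := by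
      ext x
      constructor
      · intro hx
        exact Finset.mem_Icc.2 ⟨s.min'_le x hx, s.le_max' x hx⟩
      · intro hx
        have h1 := s.min'_mem hne
        have h2 := s.max'_mem hne
        obtain ⟨h3, h4⟩ := Finset.mem_Icc.1 hx
        generalize s.min' hne = u at *
        generalize s.max' hne = v at *
        simp only [hs, Finset.mem_filter, Finset.mem_univ, true_and] at h1 h2 ⊢
        rw [Fin.le_def] at h3 h4
        omega
    rw [this]
    exact_mod_cast hΔ _ _ (s.min'_le _ (s.max'_mem hne))
  · rw [Finset.not_nonempty_iff_eq_empty] at hne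
    simp [hne]

lemma Z_le (b h : ℕ) (hb : 3 ≤ b) (Δ : Fin (b ^ h) → ℤ) (hΔ : memS _ 1 Δ) (l j : ℕ) :
    |Z b h Δ l j| ≤ 1 := by
  unfold Z
  by_cases hc : l = h ∨ j % b ≠ 0
  · simp only [hc, true_and]
    have := conv_sum Δ hΔ (j * b ^ l) ((j + 1) * b ^ l)
    simpa only [cond_iff _ _ _ _ hb] using this
  · simp [hc]

/-- number of nonzero nodes -/
def N (b h : ℕ) (Δ : Fin (b ^ h) → ℤ) : ℤ :=
  ∑ l ∈ Finset.range (h + 1), ∑ j ∈ Finset.range (b ^ h), |Z b h Δ l j|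

lemma sum_eq (b h : ℕ) (hb : 3 ≤ b) (p : ℝ) (hp : 1 ≤ p) (Δ : Fin (b ^ h) → ℤ)
    (hΔ : memS _ 1 Δ) :
    ∑ q, |(nodeMatrixHat b h).mulVec (fun t => (Δ t : ℝ)) q| ^ p = (N b h Δ : ℝ) := by
  have key : ∀ q : Fin (h + 1) × Fin (b ^ h),
      |(nodeMatrixHat b h).mulVec (fun t => (Δ t : ℝ)) q| ^ p = ((|Z b h Δ q.1 q.2| : ℤ) : ℝ) := by
    intro q
    rw [mulVec_eq b h hb]
    have h1 := Z_le b h hb Δ hΔ q.1 q.2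
    have h0 := abs_nonneg (Z b h Δ q.1 q.2)
    rw [← Int.cast_abs]
    have : |Z b h Δ q.1 q.2| = 0 ∨ |Z b h Δ q.1 q.2| = 1 := by omega
    rcases this with h | h <;> rw [h]
    · simp [Real.zero_rpow (by linarith : p ≠ 0)]
    · simp
  rw [Finset.sum_congr rfl fun q _ => key q, Fintype.sum_prod_type, N, Finset.sum_range]
  push_cast
  refine Finset.sum_congr rfl fun l _ => ?_
  rw [Finset.sum_range]

lemma sens_le (b h k : ℕ) (hb : 3 ≤ b) (p : ℝ) (hp : 1 ≤ p) (B : ℝ)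
    (hB : ∀ Δ ∈ SDk (b ^ h) 1 k, (N b h Δ : ℝ) ≤ B) :
    sens p (nodeMatrixHat b h) (SDk (b ^ h) 1 k) ^ p ≤ B ∧
    ∀ Δ ∈ SDk (b ^ h) 1 k, (N b h Δ : ℝ) ≤ sens p (nodeMatrixHat b h) (SDk (b ^ h) 1 k) ^ p := by
  have hp0 : 0 < p := by linarith
  have hN0 : ∀ Δ, (0 : ℝ) ≤ N b h Δ := by
    intro Δ
    unfold N
    exact_mod_cast Finset.sum_nonneg fun _ _ => Finset.sum_nonneg fun _ _ => abs_nonneg _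
  have hpn : ∀ Δ ∈ SDk (b ^ h) 1 k,
      pnorm p ((nodeMatrixHat b h).mulVec fun t => (Δ t : ℝ)) = (N b h Δ : ℝ) ^ (1 / p) := by
    intro Δ hΔ
    unfold pnorm
    rw [sum_eq b h hb p hp Δ hΔ.1]
  have h0 : (0 : Fin (b ^ h) → ℤ) ∈ SDk (b ^ h) 1 k := by
    simp [SDk, memS]
  have hB0 : 0 ≤ B := (hN0 0).trans (hB 0 h0)
  have hub : ∀ x ∈ ((fun Δ : Fin (b ^ h) → ℤ => pnorm p ((nodeMatrixHat b h).mulVec fun t => (Δ t : ℝ))) ''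
      SDk (b ^ h) 1 k), x ≤ B ^ (1 / p) := by
    rintro _ ⟨Δ, hΔ, rfl⟩
    simp only
    rw [hpn Δ hΔ]
    exact Real.rpow_le_rpow (hN0 Δ) (hB Δ hΔ) (by positivity)
  have hback : ∀ x : ℝ, 0 ≤ x → (x ^ (1 / p)) ^ p = x := by
    intro x hx
    rw [← Real.rpow_mul hx, one_div, inv_mul_cancel₀ hp0.ne', Real.rpow_one]
  have hge : ∀ Δ ∈ SDk (b ^ h) 1 k,
      (N b h Δ : ℝ) ^ (1 / p) ≤ sens p (nodeMatrixHat b h) (SDk (b ^ h) 1 k) := by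
    intro Δ hΔ
    rw [← hpn Δ hΔ]
    exact le_csSup ⟨_, hub⟩ ⟨Δ, hΔ, rfl⟩
  constructor
  · rw [← hback B hB0]
    refine Real.rpow_le_rpow ?_ ?_ hp0.le
    · exact (Real.rpow_nonneg (hN0 0) _).trans (hge 0 h0)
    · exact csSup_le ⟨_, ⟨0, h0, rfl⟩⟩ hub
  · intro Δ hΔ
    rw [← hback _ (hN0 Δ)]
    exact Real.rpow_le_rpow (Real.rpow_nonneg (hN0 _) _) (hge Δ hΔ) hp0.le

lemma card_counted (b n : ℕ) (hb : 3 ≤ b) :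
    ((Finset.range (b ^ (n + 1))).filter fun j => j % b ≠ 0).card + b ^ n = b ^ (n + 1) := by
  have h1 : ((Finset.range (b ^ (n + 1))).filter fun j => j % b = 0).card = b ^ n := by
    have : ((Finset.range (b ^ (n + 1))).filter fun j => j % b = 0)
        = (Finset.range (b ^ n)).image (fun i => i * b) := by
      ext x
      simp only [Finset.mem_filter, Finset.mem_range, Finset.mem_image, pow_succ]
      constructor
      · rintro ⟨hx, hx0⟩
        refine ⟨x / b, (Nat.div_lt_iff_lt_mul (by omega)).2 hx, Nat.div_mul_cancel (Nat.dvd_of_mod_eq_zero hx0)⟩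
      · rintro ⟨i, hi, rfl⟩
        exact ⟨Nat.mul_lt_mul_of_pos_right hi (by omega), by simp⟩
    rw [this, Finset.card_image_of_injective, Finset.card_range]
    intro x y hxy
    exact Nat.eq_of_mul_eq_mul_right (by omega) hxy
  have h2 := Finset.card_filter_add_card_filter_not (s := Finset.range (b ^ (n + 1))) (fun j => j % b = 0)
  rw [Finset.card_range, h1] at h2
  simp only [ne_eq]
  omega

lemma level_le_k (b h k : ℕ) (Δ : Fin (b ^ h) → ℤ)
    (hΔ : (∑ t, |Δ t|) ≤ (k : ℤ)) (l : ℕ) :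
    ∑ j ∈ Finset.range (b ^ h), |Z b h Δ l j| ≤ k := by
  refine le_trans ?_ hΔ
  calc ∑ j ∈ Finset.range (b ^ h), |Z b h Δ l j|
      ≤ ∑ j ∈ Finset.range (b ^ h), ∑ t : Fin (b ^ h), if (t : ℕ) / b ^ l = j then |Δ t| else 0 := by
        refine Finset.sum_le_sum fun j _ => ?_
        unfold Z
        refine (Finset.abs_sum_le_sum_abs _ _).trans (Finset.sum_le_sum fun t _ => ?_)
        have := abs_nonneg (Δ t)
        split_ifs <;> simp_all
    _ = ∑ t : Fin (b ^ h), ∑ j ∈ Finset.range (b ^ h), if (t : ℕ) / b ^ l = j then |Δ t| else 0 :=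
        Finset.sum_comm
    _ ≤ ∑ t, |Δ t| := by
        refine Finset.sum_le_sum fun t _ => ?_
        rw [Finset.sum_ite_eq]
        split_ifs
        · exact le_rfl
        · exact abs_nonneg _

lemma Z_zero (b h : ℕ) (hb : 3 ≤ b) (Δ : Fin (b ^ h) → ℤ) (l j : ℕ) (hl : l ≤ h)
    (hj : b ^ (h - l) ≤ j) : Z b h Δ l j = 0 := by
  unfold Z
  refine Finset.sum_eq_zero fun t _ => if_neg ?_
  rintro ⟨_, ht⟩
  have : (t : ℕ) / b ^ l < b ^ (h - l) := by
    rw [Nat.div_lt_iff_lt_mul (by positivity), ← pow_add, Nat.sub_add_cancel hl]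
    exact t.2
  omega

lemma level_le_root (b h : ℕ) (hb : 3 ≤ b) (Δ : Fin (b ^ h) → ℤ) (hΔ : memS _ 1 Δ) :
    ∑ j ∈ Finset.range (b ^ h), |Z b h Δ h j| ≤ 1 := by
  rw [Finset.sum_eq_single 0]
  · exact Z_le b h hb Δ hΔ _ _
  · intro j _ hj
    rw [Z_zero b h hb Δ h j le_rfl (by simp; omega), abs_zero]
  · intro h0
    exact absurd (Finset.mem_range.2 (by positivity)) h0

lemma level_le (b h : ℕ) (hb : 3 ≤ b) (Δ : Fin (b ^ h) → ℤ) (hΔ : memS _ 1 Δ) (i : ℕ)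
    (hi : i + 1 ≤ h) :
    ∑ j ∈ Finset.range (b ^ h), |Z b h Δ (h - (i + 1)) j| + (b : ℤ) ^ i ≤ (b : ℤ) ^ (i + 1) := by
  have hc := card_counted b i hb
  set C := (Finset.range (b ^ (i + 1))).filter fun j => j % b ≠ 0 with hC
  have : ∑ j ∈ Finset.range (b ^ h), |Z b h Δ (h - (i + 1)) j| ≤ ∑ j ∈ C, 1 := by
    calc ∑ j ∈ Finset.range (b ^ h), |Z b h Δ (h - (i + 1)) j|
        = ∑ j ∈ C, |Z b h Δ (h - (i + 1)) j| := by
          symm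
          refine Finset.sum_subset ?_ ?_
          · intro j hj
            rw [hC, Finset.mem_filter, Finset.mem_range] at hj
            exact Finset.mem_range.2 (hj.1.trans_le (Nat.pow_le_pow_right (by omega) hi))
          · intro j _ hj
            rw [abs_eq_zero]
            by_cases hj2 : b ^ (i + 1) ≤ j
            · refine Z_zero b h hb Δ _ j (by omega) ?_
              rwa [show h - (h - (i + 1)) = i + 1 by omega]
            · have hj3 : j % b = 0 := by
                by_contra h3
                exact hj (Finset.mem_filter.2 ⟨Finset.mem_range.2 (by omega), h3⟩)
              unfold Z
              refine Finset.sum_eq_zero fun t _ => if_neg ?_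
              rintro ⟨h1 | h1, _⟩
              · omega
              · exact h1 hj3
      _ ≤ _ := Finset.sum_le_sum fun j _ => Z_le b h hb Δ hΔ _ _
  simp only [Finset.sum_const, nsmul_eq_mul, mul_one] at this
  have hc' : (C.card : ℤ) + (b : ℤ) ^ i = (b : ℤ) ^ (i + 1) := by exact_mod_cast hc
  linarith

lemma upper (b h k : ℕ) (hb : 3 ≤ b) (Δ : Fin (b ^ h) → ℤ) (hΔ : Δ ∈ SDk (b ^ h) 1 k)
    (a : ℕ) (ha : a ≤ h) :
    (N b h Δ : ℝ) ≤ (k : ℝ) * ((h : ℝ) - (a : ℝ) + 1) + (b : ℝ) ^ a / (b : ℝ) := by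
  obtain ⟨hS, hk⟩ := hΔ
  set G : ℕ → ℤ := fun i => ∑ j ∈ Finset.range (b ^ h), |Z b h Δ (h - i) j| with hG
  have hN : N b h Δ = ∑ i ∈ Finset.range (h + 1), G i := by
    unfold N
    rw [← Finset.sum_range_reflect]
    refine Finset.sum_congr rfl fun i _ => ?_
    simp only [hG]
    rw [show h + 1 - 1 - i = h - i by omega]
  have hGk : ∀ i, G i ≤ k := fun i => level_le_k b h k Δ hk _
  have h1 : ∀ n, n ≤ h → ∑ i ∈ Finset.range (n + 1), G i ≤ (b : ℤ) ^ n := by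
    intro n
    induction n with
    | zero =>
      intro _
      simpa [hG] using level_le_root b h hb Δ hS
    | succ n ih =>
      intro hn
      rw [Finset.sum_range_succ]
      have := level_le b h hb Δ hS n hn
      have := ih (by omega)
      simp only [hG] at *
      linarith
  have h2 : N b h Δ = ∑ i ∈ Finset.range a, G i + ∑ i ∈ Finset.range (h + 1 - a), G (a + i) := by
    rw [hN, ← Finset.sum_range_add, show a + (h + 1 - a) = h + 1 by omega]
  have h3 : ∑ i ∈ Finset.range (h + 1 - a), G (a + i) ≤ ((h + 1 - a : ℕ) : ℤ) * k := by
    refine (Finset.sum_le_sum fun i _ => hGk (a + i)).trans ?_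
    simp
  have h3' : ((∑ i ∈ Finset.range (h + 1 - a), G (a + i) : ℤ) : ℝ) ≤ ((h : ℝ) + 1 - a) * k := by
    have : ((∑ i ∈ Finset.range (h + 1 - a), G (a + i) : ℤ) : ℝ) ≤ ((h + 1 - a : ℕ) : ℝ) * k := by
      exact_mod_cast h3
    rw [Nat.cast_sub (by omega)] at this
    push_cast at this ⊢
    exact this
  have hb0 : (0 : ℝ) < b := by exact_mod_cast (by omega : 0 < b)
  have h4 : ((∑ i ∈ Finset.range a, G i : ℤ) : ℝ) ≤ (b : ℝ) ^ a / b := by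
    cases a with
    | zero => simp
    | succ n =>
      rw [pow_succ, mul_div_assoc, div_self hb0.ne', mul_one]
      exact_mod_cast h1 n (by omega)
  rw [h2, Int.cast_add]
  linarith

/-! Lower bound -/

/-- alternating signs -/
def alt (A : Finset ℕ) (t : ℕ) : ℤ :=
  if t ∈ A then (-1) ^ (A.filter (· < t)).card else 0

lemma alt_prefix (A : Finset ℕ) (n : ℕ) :
    ∑ t ∈ Finset.range n, alt A t = if Odd (A.filter (· < n)).card then 1 else 0 := by
  induction n with
  | zero => simp
  | succ n ih =>
    rw [Finset.sum_range_succ, ih]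
    unfold alt
    by_cases hn : n ∈ A
    · have : A.filter (· < n + 1) = insert n (A.filter (· < n)) := by
        ext x
        simp only [Finset.mem_filter, Finset.mem_insert]
        constructor
        · rintro ⟨h1, h2⟩
          by_cases hx : x = n
          · exact Or.inl hx
          · exact Or.inr ⟨h1, by omega⟩
        · rintro (rfl | ⟨h1, h2⟩)
          · exact ⟨hn, by omega⟩
          · exact ⟨h1, by omega⟩
      rw [this, Finset.card_insert_of_notMem (by simp), if_pos hn]
      by_cases ho : Odd (A.filter (· < n)).card
      · rw [if_pos ho, ho.neg_one_pow, if_neg]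
        · norm_num
        · rw [Nat.odd_add_one]; exact fun h => h ho
      · rw [if_neg ho, (Nat.not_odd_iff_even.1 ho).neg_one_pow, if_pos]
        · norm_num
        · rw [Nat.odd_add_one]; exact ho
    · have : A.filter (· < n + 1) = A.filter (· < n) := by
        ext x
        simp only [Finset.mem_filter]
        constructor
        · rintro ⟨h1, h2⟩
          refine ⟨h1, ?_⟩
          by_contra h3
          exact hn (by rwa [show n = x by omega])
        · rintro ⟨h1, h2⟩
          exact ⟨h1, by omega⟩
      rw [this, if_neg hn, add_zero]

lemma alt_abs (A : Finset ℕ) (t : ℕ) : |alt A t| = if t ∈ A then 1 else 0 := by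
  unfold alt
  split_ifs
  · simp [abs_pow]
  · simp

lemma alt_mem (T : ℕ) (A : Finset ℕ) (k : ℕ) (hA : A.card ≤ k) :
    (fun t : Fin T => alt A t) ∈ SDk T 1 k := by
  constructor
  · intro i j hij
    have h1 : ∑ t ∈ Finset.Icc i j, alt A t = ∑ t ∈ Finset.Icc (i : ℕ) j, alt A t := by
      rw [← Fin.map_valEmbedding_Icc, Finset.sum_map]
      rfl
    have h2 : ∑ t ∈ Finset.Icc (i : ℕ) j, alt A t =
        ∑ t ∈ Finset.range (j + 1), alt A t - ∑ t ∈ Finset.range i, alt A t := by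
      rw [← Finset.sum_Ico_eq_sub _ (by rw [Fin.le_def] at hij; omega)]
      rfl
    simp only
    rw [h1, h2, alt_prefix, alt_prefix]
    split_ifs <;> simp
  · simp only [alt_abs]
    rw [← Finset.sum_range (fun t => if t ∈ A then (1 : ℤ) else 0), Finset.sum_ite_mem]
    simp only [Finset.sum_const, nsmul_eq_mul, mul_one]
    exact_mod_cast (Finset.card_le_card Finset.inter_subset_right).trans hA

/-- leaf below node `j` reached by always going to child number one. -/
def leaf (b : ℕ) : ℕ → ℕ → ℕ
  | 0, j => j
  | n + 1, j => b * leaf b n j + 1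

lemma leaf_div (b : ℕ) (hb : 3 ≤ b) (j : ℕ) : ∀ l n, leaf b (n + l) j / b ^ l = leaf b n j := by
  intro l
  induction l with
  | zero => simp
  | succ l ih =>
    intro n
    rw [pow_succ', ← Nat.div_div_eq_div_mul, ← ih n]
    congr 1
    change (b * leaf b (n + l) j + 1) / b = _
    rw [Nat.mul_add_div (by omega), Nat.div_eq_of_lt (by omega), add_zero]

lemma leaf_inj (b : ℕ) (hb : 3 ≤ b) : ∀ n, Function.Injective (leaf b n) := by
  intro n
  induction n with
  | zero => intro x y h; exact h
  | succ n ih =>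
    intro x y h
    apply ih
    have h' : b * leaf b n x + 1 = b * leaf b n y + 1 := h
    exact Nat.eq_of_mul_eq_mul_left (by omega) (Nat.add_right_cancel h')

lemma leaf_lt (b : ℕ) (hb : 3 ≤ b) (j n : ℕ) : leaf b n j < (j + 1) * b ^ n := by
  induction n with
  | zero => simp [leaf]
  | succ n ih =>
    have h1 : b * (leaf b n j + 1) ≤ b * ((j + 1) * b ^ n) := Nat.mul_le_mul_left _ ih
    have h2 : b * ((j + 1) * b ^ n) = (j + 1) * b ^ (n + 1) := by ring
    change b * leaf b n j + 1 < _
    rw [Nat.mul_add] at h1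
    omega

lemma leaf_lt' (b : ℕ) (hb : 3 ≤ b) (j n a : ℕ) (hj : j < b ^ a) : leaf b n j < b ^ (n + a) := by
  refine (leaf_lt b hb j n).trans_le ?_
  rw [pow_add, mul_comm]
  exact Nat.mul_le_mul_left _ hj

lemma level_ge (b n a : ℕ) (hb : 3 ≤ b) (J J' : Finset ℕ) (hJ : ∀ j ∈ J, j < b ^ a)
    (hJ' : J' ⊆ J) (l m : ℕ) (hl : m + l = n)
    (hc : ∀ j ∈ J', l = n + a ∨ leaf b m j % b ≠ 0) :
    (J'.card : ℤ) ≤ ∑ j ∈ Finset.range (b ^ (n + a)),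
      |Z b (n + a) (fun t => alt (J.image (leaf b n)) t) l j| := by
  have hsub : J'.image (leaf b m) ⊆ Finset.range (b ^ (n + a)) := by
    intro x hx
    obtain ⟨j, hj, rfl⟩ := Finset.mem_image.1 hx
    refine Finset.mem_range.2 ((leaf_lt' b hb j m a (hJ j (hJ' hj))).trans_le ?_)
    exact Nat.pow_le_pow_right (by omega) (by omega)
  refine le_trans ?_ (Finset.sum_le_sum_of_subset_of_nonneg hsub fun _ _ _ => abs_nonneg _)
  rw [Finset.sum_image fun x _ y _ h => leaf_inj b hb m h]
  have : ∀ j ∈ J', |Z b (n + a) (fun t => alt (J.image (leaf b n)) t) l (leaf b m j)| = 1 := by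
    intro j hj
    have hjJ := hJ' hj
    unfold Z
    rw [Finset.sum_eq_single ⟨leaf b n j, leaf_lt' b hb j n a (hJ j hjJ)⟩]
    · rw [if_pos ⟨hc j hj, by subst hl; exact leaf_div b hb j l m⟩, alt_abs,
        if_pos (Finset.mem_image_of_mem _ hjJ)]
    · intro t _ ht
      split_ifs with h
      · change alt _ _ = 0
        unfold alt
        rw [if_neg]
        intro htm
        obtain ⟨j', hj', hjt⟩ := Finset.mem_image.1 htm
        have h2 := h.2
        rw [← hjt, ← hl, leaf_div b hb] at h2
        have := leaf_inj b hb m h2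
        subst this
        exact ht (Fin.ext hjt.symm)
      · rfl
    · intro h0; exact absurd (Finset.mem_univ _) h0
  rw [Finset.sum_congr rfl this]
  simp

lemma exists_J (b a k : ℕ) (hb : 3 ≤ b) (hk : k ≤ b ^ a) :
    ∃ J J' : Finset ℕ, J' ⊆ J ∧ (∀ j ∈ J, j < b ^ a) ∧ J.card = k ∧
      (∀ j ∈ J', a = 0 ∨ j % b ≠ 0) ∧ (k : ℝ) * (1 - 1 / b) ≤ J'.card := by
  have hb0 : (0 : ℝ) < b := by exact_mod_cast (by omega : 0 < b)
  have hkk : (k : ℝ) * (1 - 1 / b) ≤ k := by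
    have : (0 : ℝ) ≤ k * (1 / b) := by positivity
    linarith
  cases a with
  | zero =>
    refine ⟨Finset.range k, Finset.range k, subset_rfl, ?_, by simp, by simp, by simpa using hkk⟩
    intro j hj
    exact (Finset.mem_range.1 hj).trans_le hk
  | succ n =>
    have hc := card_counted b n hb
    set C := (Finset.range (b ^ (n + 1))).filter fun j => j % b ≠ 0 with hC
    by_cases hkc : k ≤ C.card
    · obtain ⟨J, hJ, hJk⟩ := Finset.exists_subset_card_eq hkc
      refine ⟨J, J, subset_rfl, ?_, hJk, ?_, by rw [hJk]; exact hkk⟩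
      · intro j hj
        exact Finset.mem_range.1 (Finset.mem_filter.1 (hJ hj)).1
      · intro j hj
        exact Or.inr (Finset.mem_filter.1 (hJ hj)).2
    · obtain ⟨J, hCJ, hJr, hJk⟩ := Finset.exists_subsuperset_card_eq
        (Finset.filter_subset (fun j => j % b ≠ 0) (Finset.range (b ^ (n + 1))))
        (by omega : C.card ≤ k) (by simpa using hk)
      refine ⟨J, C, hCJ, ?_, hJk, ?_, ?_⟩
      · intro j hj
        exact Finset.mem_range.1 (hJr hj)
      · intro j hj
        exact Or.inr (Finset.mem_filter.1 hj).2
      · have hc' : (C.card : ℝ) + (b : ℝ) ^ n = (b : ℝ) ^ (n + 1) := by exact_mod_cast hc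
        have hk' : (k : ℝ) ≤ (b : ℝ) ^ (n + 1) := by exact_mod_cast hk
        have h1 : (0 : ℝ) ≤ 1 - 1 / b := by
          rw [sub_nonneg, div_le_one hb0]
          exact_mod_cast (by omega : 1 ≤ b)
        have h2 := mul_le_mul_of_nonneg_right hk' h1
        have h3 : (b : ℝ) ^ (n + 1) * (1 - 1 / b) = (b : ℝ) ^ (n + 1) - (b : ℝ) ^ n := by
          field_simp
          ring
        linarith

lemma lower (b h k a : ℕ) (hb : 3 ≤ b) (ha : a ≤ h) (hk : k ≤ b ^ a) :
    ∃ Δ ∈ SDk (b ^ h) 1 k, (k : ℝ) * ((h : ℝ) - (a : ℝ) + 1 - 1 / (b : ℝ)) ≤ N b h Δ := by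
  obtain ⟨n, rfl⟩ : ∃ n, h = n + a := ⟨h - a, by omega⟩
  obtain ⟨J, J', hJJ, hJ, hJk, hJc, hJb⟩ := exists_J b a k hb hk
  refine ⟨fun t => alt (J.image (leaf b n)) t,
    alt_mem _ _ _ (Finset.card_image_le.trans hJk.le), ?_⟩
  have h1 : (n : ℤ) * k + J'.card ≤ N b (n + a) (fun t => alt (J.image (leaf b n)) t) := by
    unfold N
    refine le_trans ?_ (Finset.sum_le_sum_of_subset_of_nonneg
      (Finset.range_mono (by omega : n + 1 ≤ n + a + 1))
      fun _ _ _ => Finset.sum_nonneg fun _ _ => abs_nonneg _)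
    rw [Finset.sum_range_succ]
    refine add_le_add ?_ ?_
    · have : ∀ l ∈ Finset.range n, (k : ℤ) ≤ ∑ j ∈ Finset.range (b ^ (n + a)),
          |Z b (n + a) (fun t => alt (J.image (leaf b n)) t) l j| := by
        intro l hl
        rw [Finset.mem_range] at hl
        rw [← hJk]
        obtain ⟨m, hm⟩ : ∃ m, m + 1 + l = n := ⟨n - l - 1, by omega⟩
        refine level_ge b n a hb J J hJ subset_rfl l (m + 1) hm fun j _ => Or.inr ?_
        change (b * leaf b m j + 1) % b ≠ 0
        rw [Nat.mul_add_mod, Nat.mod_eq_of_lt (by omega)]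
        omega
      have := Finset.sum_le_sum this
      simpa using this
    · refine level_ge b n a hb J J' hJ hJJ n 0 (by omega) fun j hj => ?_
      rcases hJc j hj with h | h
      · left; omega
      · right; exact h
  have h2 : (n : ℝ) * k + J'.card ≤ N b (n + a) (fun t => alt (J.image (leaf b n)) t) := by
    exact_mod_cast h1
  push_cast
  linarith

lemma SDk_mono {T k k' : ℕ} (h : k ≤ k') : SDk T 1 k ⊆ SDk T 1 k' :=
  fun _ hΔ => ⟨hΔ.1, hΔ.2.trans (by exact_mod_cast h)⟩

end Stmt16Aux

open Stmt16Aux in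
theorem stmt16 (b h k : ℕ) (hb : 3 ≤ b) (hh : 1 ≤ h) (hk1 : 1 ≤ k) (hk : k ≤ b ^ h)
    (p : ℝ) (hp : 1 ≤ p) :
    max ((k : ℝ) * ((h : ℝ) - (Nat.clog b k : ℝ) + 1 - 1 / (b : ℝ)))
        ((b : ℝ) ^ (Nat.clog b k) / (b : ℝ) * ((h : ℝ) - (Nat.clog b k : ℝ) + 2 - 1 / (b : ℝ))) ≤
      sens p (nodeMatrixHat b h) (SDk (b ^ h) 1 k) ^ p ∧
    sens p (nodeMatrixHat b h) (SDk (b ^ h) 1 k) ^ p ≤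
      (k : ℝ) * ((h : ℝ) - (Nat.clog b k : ℝ) + 1) + (b : ℝ) ^ (Nat.clog b k) / (b : ℝ) := by
  have ha : Nat.clog b k ≤ h := Nat.clog_le_of_le_pow hk
  have hka : k ≤ b ^ Nat.clog b k := Nat.le_pow_clog (by omega) k
  have hb0 : (0 : ℝ) < b := by exact_mod_cast (by omega : 0 < b)
  obtain ⟨h1, h2⟩ := sens_le b h k hb p hp _ fun Δ hΔ => upper b h k hb Δ hΔ _ ha
  refine ⟨?_, h1⟩
  obtain ⟨Δ, hΔ, hN⟩ := lower b h k _ hb ha hka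
  have hfirst := hN.trans (h2 Δ hΔ)
  refine max_le hfirst ?_
  rcases hc : Nat.clog b k with _ | n
  · refine le_trans ?_ hfirst
    rw [hc] at hka ⊢
    have hk' : k = 1 := by simp at hka; omega
    subst hk'
    have hb3 : (3 : ℝ) ≤ b := by exact_mod_cast hb
    have hh1 : (1 : ℝ) ≤ h := by exact_mod_cast hh
    have hinv : 1 / (b : ℝ) ≤ 1 / 3 := by gcongr
    have hinv0 : 0 ≤ 1 / (b : ℝ) := by positivity
    simp only [pow_zero, Nat.cast_zero, Nat.cast_one]
    nlinarith
  · have hlt : b ^ n < k := by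
      rw [← Nat.lt_clog_iff_pow_lt (by omega)]
      omega
    obtain ⟨Δ', hΔ', hN'⟩ := lower b h (b ^ n) n hb (by omega) le_rfl
    have := hN'.trans (h2 Δ' (SDk_mono hlt.le hΔ'))
    refine le_trans (le_of_eq ?_) this
    rw [pow_succ, mul_div_assoc, div_self hb0.ne', mul_one]
    push_cast
    ring
end
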